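/- arXiv:1602.02294 — 2 statements merged into one kernel-verified Lean document; each statement's English description precedes it below -/
import Mathlib

section
/- Let {S(t)} be an i.i.d. source with marginal pmf p_S on a finite alphabet 𝒮, transmitted over a discrete memoryless broadcast channel p_{Y1,Y2|X} with finite alphabets (System Π). For any (κ,𝒬1,𝒬2) ∈ Γ, there exists a joint pmf p_{S,Ŝ1,Ŝ2} on 𝒮×Ŝ_1×Ŝ_2 with 𝒮-marginal p_S and with p_{S,Ŝ_i} ∈ 𝒬_i for i=1,2, such that ℛ_i(p_{S,Ŝ1,Ŝ2}) ⊆ κ·𝒞_i(p_{Y1,Y2|X}) for i=1,2. -/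
open scoped BigOperators Classical
open Finset

noncomputable section

/-- `p` is a probability mass function on the finite type `α`. -/
def IsPMF {α : Type} [Fintype α] (p : α → ℝ) : Prop :=
  (∀ a, 0 ≤ p a) ∧ ∑ a, p a = 1

/-- Shannon entropy (base 2) of a pmf on a finite type. -/
def Hent {α : Type} [Fintype α] (p : α → ℝ) : ℝ :=
  -∑ a, p a * Real.logb 2 (p a)

/-- Mutual information `I(A;B)` of a joint pmf on `α × β` (base-2 logarithms). -/
def MI {α β : Type} [Fintype α] [Fintype β] (p : α × β → ℝ) : ℝ :=
  Hent (fun a => ∑ b, p (a, b)) + Hent (fun b => ∑ a, p (a, b)) - Hent p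

/-- Conditional mutual information `I(A;B|C)` of a joint pmf on `α × β × γ`. -/
def CMI {α β γ : Type} [Fintype α] [Fintype β] [Fintype γ] (p : α × β × γ → ℝ) : ℝ :=
  Hent (fun ac : α × γ => ∑ b, p (ac.1, b, ac.2))
    + Hent (fun bc : β × γ => ∑ a, p (a, bc.1, bc.2))
    - Hent p
    - Hent (fun c : γ => ∑ a, ∑ b, p (a, b, c))

/-- A channel: every input letter gives a pmf on outputs. -/
def IsChannel {X Z : Type} [Fintype Z] (W : X → Z → ℝ) : Prop :=
  ∀ x, IsPMF (W x)

/-- Marginal channel to receiver 1 of a broadcast channel. -/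
def margW1 {X Y1 Y2 : Type} [Fintype Y2] (W : X → Y1 × Y2 → ℝ) : X → Y1 → ℝ :=
  fun x y1 => ∑ y2, W x (y1, y2)

/-- Marginal channel to receiver 2 of a broadcast channel. -/
def margW2 {X Y1 Y2 : Type} [Fintype Y1] (W : X → Y1 × Y2 → ℝ) : X → Y2 → ℝ :=
  fun x y2 => ∑ y1, W x (y1, y2)

/-- Memoryless `n`-fold extension of a broadcast channel. -/
def nFold {X Y1 Y2 : Type} (W : X → Y1 × Y2 → ℝ) (n : ℕ)
    (x : Fin n → X) (y : (Fin n → Y1) × (Fin n → Y2)) : ℝ :=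
  ∏ t, W (x t) (y.1 t, y.2 t)

section Channel

variable {X Y1 Y2 : Type} [Fintype Y1] [Fintype Y2]

/-- Average error probability; message `M2` known at receiver 1. -/
def errP1 (W : X → Y1 × Y2 → ℝ) (n k1 k2 : ℕ) (f : Fin k1 × Fin k2 → Fin n → X)
    (g1 : (Fin n → Y1) × Fin k2 → Fin k1) (g2 : (Fin n → Y2) → Fin k2) : ℝ :=
  (1 : ℝ) / ((k1 : ℝ) * (k2 : ℝ)) *
    ∑ m : Fin k1 × Fin k2, ∑ y : (Fin n → Y1) × (Fin n → Y2),
      nFold W n (f m) y * (if g1 (y.1, m.2) = m.1 ∧ g2 y.2 = m.2 then 0 else 1)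

/-- Average error probability; message `M1` known at receiver 2. -/
def errP2 (W : X → Y1 × Y2 → ℝ) (n k1 k2 : ℕ) (f : Fin k1 × Fin k2 → Fin n → X)
    (g1 : (Fin n → Y1) → Fin k1) (g2 : (Fin n → Y2) × Fin k1 → Fin k2) : ℝ :=
  (1 : ℝ) / ((k1 : ℝ) * (k2 : ℝ)) *
    ∑ m : Fin k1 × Fin k2, ∑ y : (Fin n → Y1) × (Fin n → Y2),
      nFold W n (f m) y * (if g1 y.1 = m.1 ∧ g2 (y.2, m.1) = m.2 then 0 else 1)

/-- Average error probability; no receiver side information. -/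
def errP0 (W : X → Y1 × Y2 → ℝ) (n k1 k2 : ℕ) (f : Fin k1 × Fin k2 → Fin n → X)
    (g1 : (Fin n → Y1) → Fin k1) (g2 : (Fin n → Y2) → Fin k2) : ℝ :=
  (1 : ℝ) / ((k1 : ℝ) * (k2 : ℝ)) *
    ∑ m : Fin k1 × Fin k2, ∑ y : (Fin n → Y1) × (Fin n → Y2),
      nFold W n (f m) y * (if g1 y.1 = m.1 ∧ g2 y.2 = m.2 then 0 else 1)

/-- Achievability of a rate pair with `M2` available at receiver 1. -/
def Ach1 (W : X → Y1 × Y2 → ℝ) (R : ℝ × ℝ) : Prop :=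
  0 ≤ R.1 ∧ 0 ≤ R.2 ∧ ∀ ε : ℝ, 0 < ε →
    ∃ (n k1 k2 : ℕ), 0 < n ∧ 0 < k1 ∧ 0 < k2 ∧
      ∃ (f : Fin k1 × Fin k2 → Fin n → X) (g1 : (Fin n → Y1) × Fin k2 → Fin k1)
        (g2 : (Fin n → Y2) → Fin k2),
        R.1 ≤ Real.logb 2 (k1 : ℝ) / (n : ℝ) ∧ R.2 ≤ Real.logb 2 (k2 : ℝ) / (n : ℝ) ∧
        errP1 W n k1 k2 f g1 g2 ≤ ε

/-- Achievability of a rate pair with `M1` available at receiver 2. -/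
def Ach2 (W : X → Y1 × Y2 → ℝ) (R : ℝ × ℝ) : Prop :=
  0 ≤ R.1 ∧ 0 ≤ R.2 ∧ ∀ ε : ℝ, 0 < ε →
    ∃ (n k1 k2 : ℕ), 0 < n ∧ 0 < k1 ∧ 0 < k2 ∧
      ∃ (f : Fin k1 × Fin k2 → Fin n → X) (g1 : (Fin n → Y1) → Fin k1)
        (g2 : (Fin n → Y2) × Fin k1 → Fin k2),
        R.1 ≤ Real.logb 2 (k1 : ℝ) / (n : ℝ) ∧ R.2 ≤ Real.logb 2 (k2 : ℝ) / (n : ℝ) ∧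
        errP2 W n k1 k2 f g1 g2 ≤ ε

/-- Achievability of a rate pair with no receiver side information. -/
def Ach0 (W : X → Y1 × Y2 → ℝ) (R : ℝ × ℝ) : Prop :=
  0 ≤ R.1 ∧ 0 ≤ R.2 ∧ ∀ ε : ℝ, 0 < ε →
    ∃ (n k1 k2 : ℕ), 0 < n ∧ 0 < k1 ∧ 0 < k2 ∧
      ∃ (f : Fin k1 × Fin k2 → Fin n → X) (g1 : (Fin n → Y1) → Fin k1)
        (g2 : (Fin n → Y2) → Fin k2),
        R.1 ≤ Real.logb 2 (k1 : ℝ) / (n : ℝ) ∧ R.2 ≤ Real.logb 2 (k2 : ℝ) / (n : ℝ) ∧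
        errP0 W n k1 k2 f g1 g2 ≤ ε

/-- Capacity region `𝒞₁`: side information `M2` at receiver 1. -/
def Cap1 (W : X → Y1 × Y2 → ℝ) : Set (ℝ × ℝ) := closure {R | Ach1 W R}

/-- Capacity region `𝒞₂`: side information `M1` at receiver 2. -/
def Cap2 (W : X → Y1 × Y2 → ℝ) : Set (ℝ × ℝ) := closure {R | Ach2 W R}

/-- Private-message capacity region `𝒞`. -/
def Cap (W : X → Y1 × Y2 → ℝ) : Set (ℝ × ℝ) := closure {R | Ach0 W R}

end Channel

/-- `κ·𝒜` for a set of rate pairs. -/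
def scaleSet (κ : ℝ) (A : Set (ℝ × ℝ)) : Set (ℝ × ℝ) :=
  (fun R : ℝ × ℝ => (κ * R.1, κ * R.2)) '' A

/-- Binary entropy function (base 2). -/
def Hb (x : ℝ) : ℝ := -(x * Real.logb 2 x) - (1 - x) * Real.logb 2 (1 - x)

/-- Binary convolution `a*b = a(1-b)+(1-a)b`. -/
def bconv (a b : ℝ) : ℝ := a * (1 - b) + (1 - a) * b

/-- The region `𝒞(BS-BC(d₁,d₂))`. -/
def CBSBC (d1 d2 : ℝ) : Set (ℝ × ℝ) :=
  {R | 0 ≤ R.1 ∧ 0 ≤ R.2 ∧ ∃ α ∈ Set.Icc (0:ℝ) (1/2),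
    R.1 ≤ Hb (bconv α d1) - Hb d1 ∧ R.2 ≤ 1 - Hb (bconv α d2)}

/-- The region `𝒞(BE-BC(ε₁,ε₂))`. -/
def CBEBC (e1 e2 : ℝ) : Set (ℝ × ℝ) :=
  {R | 0 ≤ R.1 ∧ 0 ≤ R.2 ∧ ∃ β ∈ Set.Icc (0:ℝ) 1,
    R.1 ≤ β * (1 - e1) ∧ R.2 ≤ (1 - β) * (1 - e2)}

/-- 1-norm distance between two functions on a finite type. -/
def l1dist {α : Type} [Fintype α] (p q : α → ℝ) : ℝ := ∑ a, |p a - q a|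

/-- Capacity `C(p_{Y|X}) = max_{p_X} I(X;Y)` of a point-to-point channel. -/
def Cmarg {X Y : Type} [Fintype X] [Fintype Y] (Wm : X → Y → ℝ) : ℝ :=
  sSup {r | ∃ pX : X → ℝ, IsPMF pX ∧ r = MI (fun a : X × Y => pX a.1 * Wm a.1 a.2)}

section SystemPi

variable {S X Y1 Y2 US1 US2 : Type}
variable [Fintype S] [Fintype Y1] [Fintype Y2] [Fintype US1] [Fintype US2]

/-- Probability of a source block under an i.i.d. source. -/
def srcProd (pS : S → ℝ) (m : ℕ) (s : Fin m → S) : ℝ := ∏ t, pS (s t)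

/-- Joint pmf of `(S(t), Ŝ₁(t))` induced by a code for System Π. -/
def jointPi1 (pS : S → ℝ) (W : X → Y1 × Y2 → ℝ) (m n : ℕ)
    (f : (Fin m → S) → Fin n → X) (g1 : (Fin n → Y1) → Fin m → US1) (t : Fin m) :
    S × US1 → ℝ :=
  fun a => ∑ s : Fin m → S, ∑ y : (Fin n → Y1) × (Fin n → Y2),
    srcProd pS m s * nFold W n (f s) y * (if s t = a.1 ∧ g1 y.1 t = a.2 then 1 else 0)

/-- Joint pmf of `(S(t), Ŝ₂(t))` induced by a code for System Π. -/
def jointPi2 (pS : S → ℝ) (W : X → Y1 × Y2 → ℝ) (m n : ℕ)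
    (f : (Fin m → S) → Fin n → X) (g2 : (Fin n → Y2) → Fin m → US2) (t : Fin m) :
    S × US2 → ℝ :=
  fun a => ∑ s : Fin m → S, ∑ y : (Fin n → Y1) × (Fin n → Y2),
    srcProd pS m s * nFold W n (f s) y * (if s t = a.1 ∧ g2 y.2 t = a.2 then 1 else 0)

/-- Time-averaged joint pmf `(1/m)∑_t p_{S(t),Ŝ₁(t)}`. -/
def avgJoint1 (pS : S → ℝ) (W : X → Y1 × Y2 → ℝ) (m n : ℕ)
    (f : (Fin m → S) → Fin n → X) (g1 : (Fin n → Y1) → Fin m → US1) :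
    S × US1 → ℝ :=
  fun a => (1 / (m : ℝ)) * ∑ t, jointPi1 pS W m n f g1 t a

/-- Time-averaged joint pmf `(1/m)∑_t p_{S(t),Ŝ₂(t)}`. -/
def avgJoint2 (pS : S → ℝ) (W : X → Y1 × Y2 → ℝ) (m n : ℕ)
    (f : (Fin m → S) → Fin n → X) (g2 : (Fin n → Y2) → Fin m → US2) :
    S × US2 → ℝ :=
  fun a => (1 / (m : ℝ)) * ∑ t, jointPi2 pS W m n f g2 t a

/-- `(κ, 𝒬₁, 𝒬₂) ∈ Γ` : achievability for System Π (Definition 1). -/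
def InGamma (pS : S → ℝ) (W : X → Y1 × Y2 → ℝ)
    (Q1 : Set (S × US1 → ℝ)) (Q2 : Set (S × US2 → ℝ)) (κ : ℝ) : Prop :=
  ∀ ε : ℝ, 0 < ε → ∃ (m n : ℕ), 0 < m ∧
    ∃ (f : (Fin m → S) → Fin n → X) (g1 : (Fin n → Y1) → Fin m → US1)
      (g2 : (Fin n → Y2) → Fin m → US2),
      (n : ℝ) / (m : ℝ) ≤ κ + ε ∧
      (∃ q1 ∈ Q1, l1dist (avgJoint1 pS W m n f g1) q1 ≤ ε) ∧
      (∃ q2 ∈ Q2, l1dist (avgJoint2 pS W m n f g2) q2 ≤ ε)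

/-- `(κ, d₁, d₂)` achievable for System Π under distortion measures `w₁, w₂`
(Definition 2). -/
def AchDist (pS : S → ℝ) (W : X → Y1 × Y2 → ℝ)
    (w1 : S × US1 → ℝ) (w2 : S × US2 → ℝ) (κ d1 d2 : ℝ) : Prop :=
  ∀ ε : ℝ, 0 < ε → ∃ (m n : ℕ), 0 < m ∧
    ∃ (f : (Fin m → S) → Fin n → X) (g1 : (Fin n → Y1) → Fin m → US1)
      (g2 : (Fin n → Y2) → Fin m → US2),
      (n : ℝ) / (m : ℝ) ≤ κ + ε ∧
      ∑ a, avgJoint1 pS W m n f g1 a * w1 a ≤ d1 + ε ∧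
      ∑ a, avgJoint2 pS W m n f g2 a * w2 a ≤ d2 + ε

end SystemPi
section RReg

variable {S US1 US2 : Type} [Fintype S] [Fintype US1] [Fintype US2]

/-- The region `ℛ₁(p_{S,Ŝ1,Ŝ2})`: pairs `(R1,R2) ∈ ℝ²₊` with
`R1 ≤ I(S;Ŝ1|U)` and `R2 ≤ I(U;Ŝ2)` for some auxiliary `U` with
`U ↔ S ↔ (Ŝ1,Ŝ2)` a Markov chain. -/
def Rreg1 (p : S × US1 × US2 → ℝ) : Set (ℝ × ℝ) :=
  {R | 0 ≤ R.1 ∧ 0 ≤ R.2 ∧ ∃ (k : ℕ) (pU : S → Fin k → ℝ),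
    (∀ s, (∀ u, 0 ≤ pU s u) ∧ ∑ u, pU s u = 1) ∧
    R.1 ≤ CMI (fun a : S × US1 × Fin k =>
      (∑ u2, p (a.1, a.2.1, u2)) * pU a.1 a.2.2) ∧
    R.2 ≤ MI (fun a : Fin k × US2 =>
      ∑ s, ∑ u1, p (s, u1, a.2) * pU s a.1)}

/-- The region `ℛ₂(p_{S,Ŝ1,Ŝ2})`: pairs `(R1,R2) ∈ ℝ²₊` with
`R1 ≤ I(U;Ŝ1)` and `R2 ≤ I(S;Ŝ2|U)` for some auxiliary `U` with
`U ↔ S ↔ (Ŝ1,Ŝ2)` a Markov chain. -/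
def Rreg2 (p : S × US1 × US2 → ℝ) : Set (ℝ × ℝ) :=
  {R | 0 ≤ R.1 ∧ 0 ≤ R.2 ∧ ∃ (k : ℕ) (pU : S → Fin k → ℝ),
    (∀ s, (∀ u, 0 ≤ pU s u) ∧ ∑ u, pU s u = 1) ∧
    R.1 ≤ MI (fun a : Fin k × US1 =>
      ∑ s, ∑ u2, p (s, a.2, u2) * pU s a.1) ∧
    R.2 ≤ CMI (fun a : S × US2 × Fin k =>
      (∑ u1, p (a.1, u1, a.2.1)) * pU a.1 a.2.2)}

end RReg

theorem sum_pi_inj {I K Y : Type} [Fintype I] [Fintype K] [Fintype Y] [DecidableEq I]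
    [DecidableEq K] (q : I → Y → ℝ) (hq : ∀ i, ∑ y, q i y = 1) (ι : K → I)
    (hι : Function.Injective ι) (G : (K → Y) → ℝ) :
    ∑ z : I → Y, (∏ i, q i (z i)) * G (fun k => z (ι k))
      = ∑ z : K → Y, (∏ k, q (ι k) (z k)) * G z := by
  have key : ∀ z' : K → Y, ∑ z : I → Y, (∏ i, q i (z i)) *
      (if (fun k => z (ι k)) = z' then (1:ℝ) else 0) = ∏ k, q (ι k) (z' k) := by
    intro z'
    have h1 : ∀ z : I → Y, (∏ i, q i (z i)) * (if (fun k => z (ι k)) = z' then (1:ℝ) else 0)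
        = ∏ i, (q i (z i) * ∏ k, if ι k = i then (if z i = z' k then (1:ℝ) else 0) else 1) := by
      intro z
      rw [Finset.prod_mul_distrib, Finset.prod_comm]
      congr 1
      have : ∀ k, (∏ i, if ι k = i then (if z i = z' k then (1:ℝ) else 0) else 1)
          = if z (ι k) = z' k then (1:ℝ) else 0 := by
        intro k
        rw [Finset.prod_ite_eq]; simp
      simp_rw [this]
      rw [Finset.prod_ite_zero]
      simp [funext_iff]
    simp_rw [h1]
    rw [← Fintype.prod_sum (fun i y => q i y * ∏ k, if ι k = i then
      (if y = z' k then (1:ℝ) else 0) else 1)]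
    have h3 : ∏ k, q (ι k) (z' k) = ∏ i, ∏ k, if ι k = i then q i (z' k) else 1 := by
      rw [Finset.prod_comm]
      refine Finset.prod_congr rfl fun k _ => ?_
      rw [Finset.prod_ite_eq]; simp
    rw [h3]
    refine Finset.prod_congr rfl fun i _ => ?_
    by_cases hi : ∃ k, ι k = i
    · obtain ⟨k0, rfl⟩ := hi
      simp only [hι.eq_iff]
      simp
    · push Not at hi
      simp [hi, hq]
  have h2 : ∀ z : I → Y, G (fun k => z (ι k))
      = ∑ z' : K → Y, (if (fun k => z (ι k)) = z' then (1:ℝ) else 0) * G z' := by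
    intro z; simp
  simp_rw [h2, Finset.mul_sum]
  rw [Finset.sum_comm]
  refine Finset.sum_congr rfl fun z' _ => ?_
  rw [← key z', Finset.sum_mul]
  refine Finset.sum_congr rfl fun z _ => ?_
  ring

theorem sum_pi_one {I Y : Type} [Fintype I] [Fintype Y] [DecidableEq I]
    (q : I → Y → ℝ) (hq : ∀ i, ∑ y, q i y = 1) (i : I) (G : Y → ℝ) :
    ∑ z : I → Y, (∏ i, q i (z i)) * G (z i) = ∑ y, q i y * G y := by
  have := sum_pi_inj q hq (fun _ : Fin 1 => i) (fun a b _ => Subsingleton.elim a b)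
    (fun z => G (z 0))
  rw [this, ← (Equiv.funUnique (Fin 1) Y).symm.sum_comp]
  simp

theorem sum_pi_two {I Y : Type} [Fintype I] [Fintype Y] [DecidableEq I]
    (q : I → Y → ℝ) (hq : ∀ i, ∑ y, q i y = 1) (i j : I) (hij : i ≠ j) (G : Y → Y → ℝ) :
    ∑ z : I → Y, (∏ i, q i (z i)) * G (z i) (z j) = ∑ y, q i y * ∑ y', q j y' * G y y' := by
  have := sum_pi_inj q hq (![i, j]) (by
    intro a b h
    fin_cases a <;> fin_cases b <;> simp_all [eq_comm])
    (fun z => G (z 0) (z 1))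
  simp only [Matrix.cons_val_zero, Matrix.cons_val_one] at this
  rw [this, ← (finTwoArrowEquiv Y).symm.sum_comp, Fintype.sum_prod_type]
  simp [Finset.mul_sum, mul_assoc]

theorem sum_pi_all {I Y : Type} [Fintype I] [Fintype Y] [DecidableEq I]
    (q : I → Y → ℝ) (hq : ∀ i, ∑ y, q i y = 1) :
    ∑ z : I → Y, (∏ i, q i (z i)) = 1 := by
  rw [← Fintype.prod_sum]; simp [hq]

/-- Weak law of large numbers on finite types, via Chebyshev. -/
theorem wlln {Ω : Type} [Fintype Ω] (q h : Ω → ℝ) (hq : IsPMF q) (N : ℕ) (hN : 0 < N)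
    (δ : ℝ) (hδ : 0 < δ) :
    ∑ ω : Fin N → Ω, (∏ j, q (ω j)) *
      (if ∑ j, h (ω j) ≤ N * ((∑ a, q a * h a) - δ) then (1:ℝ) else 0)
      ≤ (∑ a, q a * (h a - ∑ b, q b * h b) ^ 2) / (N * δ ^ 2) := by
  set μ := ∑ a, q a * h a with hμ
  have hN' : (0:ℝ) < N := by exact_mod_cast hN
  have h0 : ∑ a, q a * (h a - μ) = 0 := by
    simp only [mul_sub, Finset.sum_sub_distrib, ← Finset.sum_mul, hq.2]
    rw [← hμ]; ring
  have h1 : ∀ ω : Fin N → Ω, (∏ j, q (ω j)) *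
      (if ∑ j, h (ω j) ≤ N * (μ - δ) then (1:ℝ) else 0)
      ≤ (∏ j, q (ω j)) * (∑ i, ∑ j, (h (ω i) - μ) * (h (ω j) - μ)) / (N * δ) ^ 2 := by
    intro ω
    rw [mul_div_assoc]
    apply mul_le_mul_of_nonneg_left _ (Finset.prod_nonneg fun j _ => hq.1 _)
    rw [← Finset.sum_mul_sum, ← sq]
    have hs : ∑ i, (h (ω i) - μ) = ∑ i, h (ω i) - N * μ := by
      simp [Finset.sum_sub_distrib]
    rw [hs, le_div_iff₀ (by positivity)]
    split_ifs with hc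
    · have : (N:ℝ) * δ ≤ -(∑ i, h (ω i) - N * μ) := by linarith
      have h2 : 0 ≤ (N:ℝ) * δ := by positivity
      nlinarith
    · rw [zero_mul]; positivity
  refine (Finset.sum_le_sum fun ω _ => h1 ω).trans ?_
  rw [← Finset.sum_div]
  have h2 : ∑ ω : Fin N → Ω, (∏ j, q (ω j)) * (∑ i, ∑ j, (h (ω i) - μ) * (h (ω j) - μ))
      = N * ∑ a, q a * (h a - μ) ^ 2 := by
    simp_rw [Finset.mul_sum]
    rw [Finset.sum_comm]
    have : ∀ i : Fin N, ∑ ω : Fin N → Ω, ∑ j, (∏ j, q (ω j)) * ((h (ω i) - μ) * (h (ω j) - μ))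
        = ∑ a, q a * (h a - μ) ^ 2 := by
      intro i
      rw [Finset.sum_comm, Finset.sum_eq_single i]
      · rw [sum_pi_one (fun _ => q) (fun _ => hq.2) i (fun a => (h a - μ) * (h a - μ))]
        simp [sq]
      · intro j _ hj
        rw [sum_pi_two (fun _ => q) (fun _ => hq.2) i j hj.symm
          (fun a b => (h a - μ) * (h b - μ))]
        apply Finset.sum_eq_zero
        intro a _
        have : ∑ b, q b * ((h a - μ) * (h b - μ)) = (h a - μ) * ∑ b, q b * (h b - μ) := by
          rw [Finset.mul_sum]; exact Finset.sum_congr rfl fun b _ => by ring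
        rw [this, h0]; ring
      · simp
    simp_rw [this]
    simp [Finset.mul_sum]
  rw [h2]
  apply le_of_eq
  field_simp

/-- One-shot superposition random coding bound. -/
theorem oneshot {U A Z1 Z2 : Type} [Fintype U] [Fintype A] [Fintype Z1] [Fintype Z2]
    (P : U → ℝ) (hP : IsPMF P) (Q : U → A → ℝ) (hQ : IsChannel Q)
    (V : A → Z1 × Z2 → ℝ) (hV : IsChannel V)
    (d1 : U → A → Z1 → ℝ) (d2 : U → Z2 → ℝ)
    (hd1 : ∀ u a z, 0 ≤ d1 u a z) (hd2 : ∀ u z, 0 ≤ d2 u z)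
    (hs1 : ∀ u z, ∑ a, Q u a * d1 u a z ≤ 1) (hs2 : ∀ z, ∑ u, P u * d2 u z ≤ 1)
    (T1 T2 : ℝ) (hT1 : 0 < T1) (hT2 : 0 < T2) (k1 k2 : ℕ) (hk1 : 0 < k1) (hk2 : 0 < k2) :
    ∃ (f : Fin k1 × Fin k2 → A) (g1 : Z1 × Fin k2 → Fin k1) (g2 : Z2 → Fin k2),
      (1 : ℝ) / ((k1 : ℝ) * (k2 : ℝ)) * ∑ m : Fin k1 × Fin k2, ∑ z : Z1 × Z2,
        V (f m) z * (if g1 (z.1, m.2) = m.1 ∧ g2 z.2 = m.2 then 0 else 1)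
      ≤ (∑ u, P u * ∑ a, Q u a * ∑ z, V a z * (if d1 u a z.1 ≤ T1 then 1 else 0))
        + (∑ u, P u * ∑ a, Q u a * ∑ z, V a z * (if d2 u z.2 ≤ T2 then 1 else 0))
        + (k1 - 1) / T1 + (k2 - 1) / T2 := by
  have : Nonempty (Fin k1) := ⟨⟨0, hk1⟩⟩
  have : Nonempty (Fin k2) := ⟨⟨0, hk2⟩⟩
  set w0 : U × (Fin k1 → A) → ℝ := fun x => P x.1 * ∏ i, Q x.1 (x.2 i) with hw0
  have hw0n : ∀ x, 0 ≤ w0 x := fun x =>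
    mul_nonneg (hP.1 _) (Finset.prod_nonneg fun i _ => (hQ _).1 _)
  have hQ1 : ∀ u, ∑ a : Fin k1 → A, ∏ i, Q u (a i) = 1 := fun u =>
    sum_pi_all (fun _ => Q u) (fun _ => (hQ u).2)
  have hw0s : ∑ x, w0 x = 1 := by
    rw [Fintype.sum_prod_type]
    simp only [hw0, ← Finset.mul_sum, hQ1, mul_one, hP.2]
  -- marginals of the cloud
  have marg1 : ∀ (i : Fin k1) (G : U → A → ℝ),
      ∑ x, w0 x * G x.1 (x.2 i) = ∑ u, P u * ∑ a, Q u a * G u a := by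
    intro i G
    rw [Fintype.sum_prod_type]
    refine Finset.sum_congr rfl fun u _ => ?_
    simp only [hw0, mul_assoc, ← Finset.mul_sum]
    rw [sum_pi_one (fun _ => Q u) (fun _ => (hQ u).2) i (G u)]
  have marg2 : ∀ (i i' : Fin k1) (_ : i ≠ i') (G : U → A → A → ℝ),
      ∑ x, w0 x * G x.1 (x.2 i) (x.2 i') = ∑ u, P u * ∑ a, Q u a * ∑ a', Q u a' * G u a a' := by
    intro i i' hi G
    rw [Fintype.sum_prod_type]
    refine Finset.sum_congr rfl fun u _ => ?_
    simp only [hw0, mul_assoc, ← Finset.mul_sum]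
    rw [sum_pi_two (fun _ => Q u) (fun _ => (hQ u).2) i i' hi (G u)]
  set w : (Fin k2 → U × (Fin k1 → A)) → ℝ := fun c => ∏ j, w0 (c j) with hw
  have hwn : ∀ c, 0 ≤ w c := fun c => Finset.prod_nonneg fun j _ => hw0n _
  have hws : ∑ c, w c = 1 := sum_pi_all (fun _ => w0) (fun _ => hw0s)
  set e1 : ℝ := ∑ u, P u * ∑ a, Q u a * ∑ z, V a z * (if d1 u a z.1 ≤ T1 then 1 else 0) with he1
  set e2 : ℝ := ∑ u, P u * ∑ a, Q u a * ∑ z, V a z * (if d2 u z.2 ≤ T2 then 1 else 0) with he2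
  -- the union bound
  set B : (Fin k2 → U × (Fin k1 → A)) → Fin k1 × Fin k2 → ℝ := fun c m =>
    (∑ z, V ((c m.2).2 m.1) z * (if d1 (c m.2).1 ((c m.2).2 m.1) z.1 ≤ T1 then 1 else 0))
    + (∑ z, V ((c m.2).2 m.1) z * (if d2 (c m.2).1 z.2 ≤ T2 then 1 else 0))
    + (∑ i ∈ Finset.univ.erase m.1, (∑ z, V ((c m.2).2 m.1) z *
        d1 (c m.2).1 ((c m.2).2 i) z.1) / T1)
    + (∑ j ∈ Finset.univ.erase m.2, (∑ z, V ((c m.2).2 m.1) z *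
        d2 (c j).1 z.2) / T2) with hB
  have hEB : ∀ m, ∑ c, w c * B c m ≤ e1 + e2 + (k1 - 1) / T1 + (k2 - 1) / T2 := by
    rintro ⟨i, j⟩
    simp only [hB, mul_add, Finset.sum_add_distrib]
    refine add_le_add (add_le_add (add_le_add ?_ ?_) ?_) ?_
    · apply le_of_eq
      rw [sum_pi_one (fun _ => w0) (fun _ => hw0s) j (fun x => ∑ z, V (x.2 i) z *
        (if d1 x.1 (x.2 i) z.1 ≤ T1 then 1 else 0))]
      rw [marg1 i (fun u a => ∑ z, V a z * (if d1 u a z.1 ≤ T1 then 1 else 0))]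
    · apply le_of_eq
      rw [sum_pi_one (fun _ => w0) (fun _ => hw0s) j (fun x => ∑ z, V (x.2 i) z *
        (if d2 x.1 z.2 ≤ T2 then 1 else 0))]
      rw [marg1 i (fun u a => ∑ z, V a z * (if d2 u z.2 ≤ T2 then 1 else 0))]
    · simp_rw [Finset.mul_sum]
      rw [Finset.sum_comm]
      have : ∀ i' ∈ Finset.univ.erase i, ∑ c, w c * ((∑ z, V ((c j).2 i) z *
        d1 (c j).1 ((c j).2 i') z.1) / T1) ≤ 1 / T1 := by
        intro i' hi'
        rw [sum_pi_one (fun _ => w0) (fun _ => hw0s) j (fun x => (∑ z, V (x.2 i) z *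
          d1 x.1 (x.2 i') z.1) / T1)]
        rw [marg2 i i' (Finset.ne_of_mem_erase hi').symm
          (fun u a a' => (∑ z, V a z * d1 u a' z.1) / T1)]
        have h1 : ∀ u a, ∑ a', Q u a' * ((∑ z, V a z * d1 u a' z.1) / T1) ≤ 1 / T1 := by
          intro u a
          have : ∑ a', Q u a' * ((∑ z, V a z * d1 u a' z.1) / T1)
              = (∑ z, V a z * ∑ a', Q u a' * d1 u a' z.1) / T1 := by
            simp_rw [mul_div_assoc', ← Finset.sum_div, Finset.mul_sum]
            rw [Finset.sum_comm]
            congr 1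
            refine Finset.sum_congr rfl fun _ _ => Finset.sum_congr rfl fun _ _ => by ring
          rw [this]
          apply div_le_div_of_nonneg_right _ hT1.le
          calc _ ≤ ∑ z, V a z * 1 := Finset.sum_le_sum fun z _ =>
                mul_le_mul_of_nonneg_left (hs1 u z.1) ((hV a).1 z)
            _ = 1 := by simp [(hV a).2]
        calc _ ≤ ∑ u, P u * ∑ a, Q u a * (1 / T1) := Finset.sum_le_sum fun u _ =>
              mul_le_mul_of_nonneg_left (Finset.sum_le_sum fun a _ =>
                mul_le_mul_of_nonneg_left (h1 u a) ((hQ u).1 a)) (hP.1 u)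
          _ = 1 / T1 := by simp only [← Finset.sum_mul, (hQ _).2, hP.2, one_mul]
      refine (Finset.sum_le_sum this).trans ?_
      rw [Finset.sum_const, nsmul_eq_mul, mul_one_div]
      apply div_le_div_of_nonneg_right _ hT1.le
      rw [Finset.card_erase_of_mem (Finset.mem_univ _), Finset.card_univ, Fintype.card_fin,
        Nat.cast_sub hk1, Nat.cast_one]
    · simp_rw [Finset.mul_sum]
      rw [Finset.sum_comm]
      have : ∀ j' ∈ Finset.univ.erase j, ∑ c, w c * ((∑ z, V ((c j).2 i) z *
        d2 (c j').1 z.2) / T2) ≤ 1 / T2 := by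
        intro j' hj'
        rw [sum_pi_two (fun _ => w0) (fun _ => hw0s) j j' (Finset.ne_of_mem_erase hj').symm
          (fun x x' => (∑ z, V (x.2 i) z * d2 x'.1 z.2) / T2)]
        have h1 : ∀ a, ∑ x', w0 x' * ((∑ z, V a z * d2 x'.1 z.2) / T2) ≤ 1 / T2 := by
          intro a
          have : ∑ x', w0 x' * ((∑ z, V a z * d2 x'.1 z.2) / T2)
              = (∑ z, V a z * ∑ x', w0 x' * d2 x'.1 z.2) / T2 := by
            simp_rw [mul_div_assoc', ← Finset.sum_div, Finset.mul_sum]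
            rw [Finset.sum_comm]
            congr 1
            refine Finset.sum_congr rfl fun _ _ => Finset.sum_congr rfl fun _ _ => by ring
          rw [this]
          apply div_le_div_of_nonneg_right _ hT2.le
          have h2 : ∀ z2, ∑ x', w0 x' * d2 x'.1 z2 ≤ 1 := by
            intro z2
            rw [marg1 i (fun u _ => d2 u z2)]
            simp only [← Finset.sum_mul, (hQ _).2, one_mul]
            exact hs2 z2
          calc _ ≤ ∑ z, V a z * 1 := Finset.sum_le_sum fun z _ =>
                mul_le_mul_of_nonneg_left (h2 z.2) ((hV a).1 z)
            _ = 1 := by simp [(hV a).2]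
        calc _ ≤ ∑ x, w0 x * (1 / T2) := Finset.sum_le_sum fun x _ =>
              mul_le_mul_of_nonneg_left (h1 _) (hw0n x)
          _ = 1 / T2 := by rw [← Finset.sum_mul, hw0s, one_mul]
      refine (Finset.sum_le_sum this).trans ?_
      rw [Finset.sum_const, nsmul_eq_mul, mul_one_div]
      apply div_le_div_of_nonneg_right _ hT2.le
      rw [Finset.card_erase_of_mem (Finset.mem_univ _), Finset.card_univ, Fintype.card_fin,
        Nat.cast_sub hk2, Nat.cast_one]
  -- pick a good codebook
  obtain ⟨c, hc⟩ : ∃ c, ∑ m, B c m ≤ ((k1:ℝ) * k2) * (e1 + e2 + (k1 - 1) / T1 + (k2 - 1) / T2) := by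
    by_contra hcon
    push Not at hcon
    have h1 : ∑ c, w c * ∑ m, B c m ≤ ((k1:ℝ) * k2) * (e1 + e2 + (k1 - 1) / T1 + (k2 - 1) / T2) := by
      simp_rw [Finset.mul_sum]
      rw [Finset.sum_comm]
      refine (Finset.sum_le_sum fun m _ => hEB m).trans ?_
      apply le_of_eq
      rw [Finset.sum_const]
      simp
      ring
    have h2 : ((k1:ℝ) * k2) * (e1 + e2 + (k1 - 1) / T1 + (k2 - 1) / T2) < ∑ c, w c * ∑ m, B c m := by
      have h3 : ((k1:ℝ) * k2) * (e1 + e2 + (k1 - 1) / T1 + (k2 - 1) / T2)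
          = ∑ c, w c * (((k1:ℝ) * k2) * (e1 + e2 + (k1 - 1) / T1 + (k2 - 1) / T2)) := by
        rw [← Finset.sum_mul, hws, one_mul]
      rw [h3]
      apply Finset.sum_lt_sum
      · intro c _; exact mul_le_mul_of_nonneg_left (hcon c).le (hwn c)
      · obtain ⟨c, _, hc⟩ : ∃ c ∈ Finset.univ, 0 < w c := by
          apply Finset.exists_lt_of_sum_lt
          simp [hws]
        exact ⟨c, Finset.mem_univ _, mul_lt_mul_of_pos_left (hcon c) hc⟩
    linarith
  refine ⟨fun m => (c m.2).2 m.1,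
    fun zj => if h : ∃ i, T1 < d1 (c zj.2).1 ((c zj.2).2 i) zj.1 then h.choose
      else Classical.arbitrary _,
    fun z2 => if h : ∃ j, T2 < d2 (c j).1 z2 then h.choose else Classical.arbitrary _, ?_⟩
  have hkk : (0:ℝ) < (k1:ℝ) * k2 := by positivity
  rw [one_div_mul_eq_div, div_le_iff₀ hkk, mul_comm _ ((k1:ℝ) * k2)]
  refine le_trans (Finset.sum_le_sum fun m _ => ?_) hc
  obtain ⟨i, j⟩ := m
  simp only [hB, ← Finset.sum_div]
  rw [Finset.sum_comm, Finset.sum_comm (s := Finset.univ.erase j), Finset.sum_div, Finset.sum_div,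
    ← Finset.sum_add_distrib, ← Finset.sum_add_distrib, ← Finset.sum_add_distrib]
  refine Finset.sum_le_sum fun z _ => ?_
  rw [← Finset.mul_sum, ← Finset.mul_sum, mul_div_assoc, mul_div_assoc, ← mul_add, ← mul_add,
    ← mul_add]
  refine mul_le_mul_of_nonneg_left ?_ ((hV _).1 z)
  have n1 : 0 ≤ (∑ i' ∈ Finset.univ.erase i, d1 (c j).1 ((c j).2 i') z.1) / T1 :=
    div_nonneg (Finset.sum_nonneg fun _ _ => hd1 _ _ _) hT1.le
  have n2 : 0 ≤ (∑ j' ∈ Finset.univ.erase j, d2 (c j').1 z.2) / T2 :=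
    div_nonneg (Finset.sum_nonneg fun _ _ => hd2 _ _) hT2.le
  have n3 : (0:ℝ) ≤ if d1 (c j).1 ((c j).2 i) z.1 ≤ T1 then 1 else 0 := by split_ifs <;> norm_num
  have n4 : (0:ℝ) ≤ if d2 (c j).1 z.2 ≤ T2 then 1 else 0 := by split_ifs <;> norm_num
  by_cases c1 : d1 (c j).1 ((c j).2 i) z.1 ≤ T1
  · rw [if_pos c1] at n3 ⊢
    have : (if ((if h : ∃ i, T1 < d1 (c j).1 ((c j).2 i) z.1 then h.choose
      else Classical.arbitrary _) = i ∧ (if h : ∃ j, T2 < d2 (c j).1 z.2 then h.choose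
        else Classical.arbitrary _) = j) then (0:ℝ) else 1) ≤ 1 := by
      split_ifs <;> norm_num
    linarith
  by_cases c2 : d2 (c j).1 z.2 ≤ T2
  · rw [if_pos c2] at n4 ⊢
    have : (if ((if h : ∃ i, T1 < d1 (c j).1 ((c j).2 i) z.1 then h.choose
      else Classical.arbitrary _) = i ∧ (if h : ∃ j, T2 < d2 (c j).1 z.2 then h.choose
        else Classical.arbitrary _) = j) then (0:ℝ) else 1) ≤ 1 := by
      split_ifs <;> norm_num
    linarith
  have x1 : ∃ i, T1 < d1 (c j).1 ((c j).2 i) z.1 := ⟨i, not_le.1 c1⟩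
  have x2 : ∃ j, T2 < d2 (c j).1 z.2 := ⟨j, not_le.1 c2⟩
  rw [if_neg c1, if_neg c2, dif_pos x1, dif_pos x2]
  by_cases y1 : x1.choose = i
  · by_cases y2 : x2.choose = j
    · rw [if_pos ⟨y1, y2⟩]; linarith
    · rw [if_neg (fun h => y2 h.2)]
      have : (1:ℝ) ≤ (∑ j' ∈ Finset.univ.erase j, d2 (c j').1 z.2) / T2 := by
        rw [le_div_iff₀ hT2, one_mul]
        exact x2.choose_spec.le.trans (Finset.single_le_sum (f := fun j' => d2 (c j').1 z.2)
          (fun _ _ => hd2 _ _) (Finset.mem_erase.2 ⟨y2, Finset.mem_univ _⟩))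
      linarith
  · rw [if_neg (fun h => y1 h.1)]
    have : (1:ℝ) ≤ (∑ i' ∈ Finset.univ.erase i, d1 (c j).1 ((c j).2 i') z.1) / T1 := by
      rw [le_div_iff₀ hT1, one_mul]
      exact x1.choose_spec.le.trans
        (Finset.single_le_sum (f := fun i' => d1 (c j).1 ((c j).2 i') z.1)
        (fun _ _ => hd1 _ _ _) (Finset.mem_erase.2 ⟨y1, Finset.mem_univ _⟩))
    linarith

theorem nFold_isChannel {X Y1 Y2 : Type} [Fintype Y1] [Fintype Y2]
    (W : X → Y1 × Y2 → ℝ) (hW : IsChannel W) (n : ℕ) : IsChannel (nFold W n) := by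
  intro x
  refine ⟨fun y => Finset.prod_nonneg fun t _ => (hW _).1 _, ?_⟩
  rw [← (Equiv.arrowProdEquivProdArrow (Fin n) (fun _ => Y1) (fun _ => Y2)).sum_comp]
  exact sum_pi_all (fun t => W (x t)) (fun t => (hW _).2)

theorem sum_unzip {U A Z1 Z2 : Type} [Fintype U] [Fintype A] [Fintype Z1] [Fintype Z2] (N : ℕ)
    (F : (Fin N → U) → (Fin N → A) → (Fin N → Z1) × (Fin N → Z2) → ℝ) :
    ∑ u, ∑ a, ∑ z, F u a z = ∑ ω : Fin N → U × A × Z1 × Z2,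
      F (fun j => (ω j).1) (fun j => (ω j).2.1) (fun j => (ω j).2.2.1, fun j => (ω j).2.2.2) := by
  rw [← (Equiv.arrowProdEquivProdArrow (Fin N) (fun _ => U) (fun _ => A × Z1 × Z2)).symm.sum_comp,
    Fintype.sum_prod_type]
  refine Finset.sum_congr rfl fun u _ => ?_
  rw [← (Equiv.arrowProdEquivProdArrow (Fin N) (fun _ => A) (fun _ => Z1 × Z2)).symm.sum_comp,
    Fintype.sum_prod_type]
  refine Finset.sum_congr rfl fun a _ => ?_
  rw [← (Equiv.arrowProdEquivProdArrow (Fin N) (fun _ => Z1) (fun _ => Z2)).symm.sum_comp]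
  rfl

theorem iid_tail {U A Z1 Z2 : Type} [Fintype U] [Fintype A] [Fintype Z1] [Fintype Z2]
    (P : U → ℝ) (hP : IsPMF P) (Q : U → A → ℝ) (hQ : IsChannel Q)
    (V : A → Z1 × Z2 → ℝ) (hV : IsChannel V)
    (d : U → A → Z1 × Z2 → ℝ)
    (hpos : ∀ u a z, 0 < P u * (Q u a * V a z) → 0 < d u a z)
    (L : ℝ) (hL : L = ∑ u, P u * ∑ a, Q u a * ∑ z, V a z * Real.logb 2 (d u a z))
    (δ : ℝ) (hδ : 0 < δ) : ∃ C : ℝ, ∀ N : ℕ, 0 < N →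
    (∑ u : Fin N → U, (∏ j, P (u j)) * ∑ a : Fin N → A, (∏ j, Q (u j) (a j)) *
      ∑ z, nFold V N a z * (if ∏ j, d (u j) (a j) (z.1 j, z.2 j) ≤ (2:ℝ) ^ (N * (L - δ))
        then 1 else 0)) ≤ C / N := by
  set q : U × A × Z1 × Z2 → ℝ := fun ω => P ω.1 * (Q ω.1 ω.2.1 * V ω.2.1 ω.2.2) with hqdef
  have hq : IsPMF q := by
    refine ⟨fun ω => mul_nonneg (hP.1 _) (mul_nonneg ((hQ _).1 _) ((hV _).1 _)), ?_⟩
    rw [Fintype.sum_prod_type]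
    simp_rw [Fintype.sum_prod_type (γ := ℝ) (α₁ := A)]
    simp only [hqdef, ← Finset.mul_sum, (hV _).2, (hQ _).2, hP.2, mul_one]
  set h : U × A × Z1 × Z2 → ℝ := fun ω => Real.logb 2 (d ω.1 ω.2.1 ω.2.2) with hh
  have hLq : L = ∑ ω, q ω * h ω := by
    rw [hL, Fintype.sum_prod_type]
    refine Finset.sum_congr rfl fun u _ => ?_
    rw [Fintype.sum_prod_type, Finset.mul_sum]
    refine Finset.sum_congr rfl fun a _ => ?_
    rw [Finset.mul_sum, Finset.mul_sum]
    refine Finset.sum_congr rfl fun z _ => ?_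
    simp only [hqdef, hh]; ring
  refine ⟨(∑ a, q a * (h a - ∑ b, q b * h b) ^ 2) / δ ^ 2, fun N hN => ?_⟩
  have hw := wlln q h hq N hN δ hδ
  have e : (∑ a, q a * (h a - ∑ b, q b * h b) ^ 2) / δ ^ 2 / N
    = (∑ a, q a * (h a - ∑ b, q b * h b) ^ 2) / (N * δ ^ 2) := by
    rw [div_div, mul_comm]
  rw [e]
  refine le_trans ?_ hw
  simp_rw [Finset.mul_sum]
  rw [sum_unzip N (fun u a z => (∏ j, P (u j)) * ((∏ j, Q (u j) (a j)) * (nFold V N a z *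
    (if ∏ j, d (u j) (a j) (z.1 j, z.2 j) ≤ (2:ℝ) ^ (N * (L - δ)) then 1 else 0))))]
  refine Finset.sum_le_sum fun ω _ => ?_
  have e2 : (∏ j, P (ω j).1) * ((∏ j, Q (ω j).1 (ω j).2.1) *
      nFold V N (fun j => (ω j).2.1) (fun j => (ω j).2.2.1, fun j => (ω j).2.2.2))
      = ∏ j, q (ω j) := by
    simp only [nFold, hqdef, Finset.prod_mul_distrib]
  have hprod : 0 ≤ ∏ j, q (ω j) := Finset.prod_nonneg fun j _ => hq.1 _
  rw [← mul_assoc (∏ j, Q (ω j).1 (ω j).2.1), ← mul_assoc, e2]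
  rcases hprod.eq_or_lt with h0 | h0
  · rw [← h0]; simp
  · apply mul_le_mul_of_nonneg_left _ hprod
    have hqj : ∀ j, 0 < q (ω j) := by
      intro j
      rcases (hq.1 (ω j)).eq_or_lt with h1 | h1
      · exact absurd (Finset.prod_eq_zero (Finset.mem_univ j) h1.symm) h0.ne'
      · exact h1
    have hdj : ∀ j, 0 < d (ω j).1 (ω j).2.1 (ω j).2.2 := fun j => hpos _ _ _ (hqj j)
    split_ifs with c1 c2
    · exact le_rfl
    · exfalso
      apply c2
      rw [← hLq]
      have : ∑ j, h (ω j) = Real.logb 2 (∏ j, d (ω j).1 (ω j).2.1 (ω j).2.2) := by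
        rw [Real.logb_prod _ _ (fun j _ => (hdj j).ne')]
      rw [this]
      rw [Real.logb_le_iff_le_rpow (by norm_num) (Finset.prod_pos fun j _ => hdj j)]
      exact c1
    · norm_num
    · exact le_rfl

theorem iid_code {U A Z1 Z2 : Type} [Fintype U] [Fintype A] [Fintype Z1] [Fintype Z2]
    (P : U → ℝ) (hP : IsPMF P) (Q : U → A → ℝ) (hQ : IsChannel Q)
    (V : A → Z1 × Z2 → ℝ) (hV : IsChannel V)
    (d1 : U → A → Z1 → ℝ) (d2 : U → Z2 → ℝ)
    (hd1 : ∀ u a z, 0 ≤ d1 u a z) (hd2 : ∀ u z, 0 ≤ d2 u z)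
    (hs1 : ∀ u z, ∑ a, Q u a * d1 u a z ≤ 1) (hs2 : ∀ z, ∑ u, P u * d2 u z ≤ 1)
    (hpos1 : ∀ u a z, 0 < P u * (Q u a * V a z) → 0 < d1 u a z.1)
    (hpos2 : ∀ u a z, 0 < P u * (Q u a * V a z) → 0 < d2 u z.2)
    (L1 L2 : ℝ)
    (hL1 : L1 = ∑ u, P u * ∑ a, Q u a * ∑ z, V a z * Real.logb 2 (d1 u a z.1))
    (hL2 : L2 = ∑ u, P u * ∑ a, Q u a * ∑ z, V a z * Real.logb 2 (d2 u z.2))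
    (δ ε : ℝ) (hδ : 0 < δ) (hε : 0 < ε) :
    ∀ᶠ N : ℕ in Filter.atTop, ∀ k1 k2 : ℕ, 0 < k1 → 0 < k2 →
      (k1 : ℝ) - 1 ≤ (2:ℝ) ^ (N * (L1 - δ)) → (k2 : ℝ) - 1 ≤ (2:ℝ) ^ (N * (L2 - δ)) →
      ∃ (f : Fin k1 × Fin k2 → Fin N → A) (g1 : (Fin N → Z1) × Fin k2 → Fin k1)
        (g2 : (Fin N → Z2) → Fin k2), errP1 V N k1 k2 f g1 g2 ≤ ε := by
  obtain ⟨C1, hC1⟩ := iid_tail P hP Q hQ V hV (fun u a z => d1 u a z.1)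
    hpos1 L1 hL1 (δ/2) (by positivity)
  obtain ⟨C2, hC2⟩ := iid_tail P hP Q hQ V hV (fun u a z => d2 u z.2)
    hpos2 L2 hL2 (δ/2) (by positivity)
  have hlim : Filter.Tendsto (fun N : ℕ => C1 / N + C2 / N + ((2:ℝ) ^ (-(δ/2))) ^ N
      + ((2:ℝ) ^ (-(δ/2))) ^ N) Filter.atTop (nhds (0 + 0 + 0 + 0)) := by
    have h1 : (2:ℝ) ^ (-(δ/2)) < 1 := Real.rpow_lt_one_of_one_lt_of_neg (by norm_num) (by linarith)
    have h2 : (0:ℝ) ≤ (2:ℝ) ^ (-(δ/2)) := by positivity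
    exact (((tendsto_const_div_atTop_nhds_zero_nat C1).add
      (tendsto_const_div_atTop_nhds_zero_nat C2)).add
      (tendsto_pow_atTop_nhds_zero_of_lt_one h2 h1)).add
      (tendsto_pow_atTop_nhds_zero_of_lt_one h2 h1)
  have hev := hlim.eventually (ge_mem_nhds (show (0:ℝ)+0+0+0 < ε by simpa using hε))
  filter_upwards [hev, Filter.eventually_gt_atTop 0] with N hN hN0 k1 k2 hk1 hk2 hr1 hr2
  obtain ⟨f, g1, g2, hfg⟩ := oneshot (fun u : Fin N → U => ∏ j, P (u j))
    ⟨fun u => Finset.prod_nonneg fun j _ => hP.1 _, sum_pi_all (fun _ => P) (fun _ => hP.2)⟩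
    (fun u (a : Fin N → A) => ∏ j, Q (u j) (a j))
    (fun u => ⟨fun a => Finset.prod_nonneg fun j _ => (hQ _).1 _,
      sum_pi_all (fun j => Q (u j)) (fun j => (hQ _).2)⟩)
    (nFold V N) (nFold_isChannel V hV N)
    (fun u a z => ∏ j, d1 (u j) (a j) (z j)) (fun u z => ∏ j, d2 (u j) (z j))
    (fun u a z => Finset.prod_nonneg fun j _ => hd1 _ _ _)
    (fun u z => Finset.prod_nonneg fun j _ => hd2 _ _)
    (fun u z => by
      simp_rw [← Finset.prod_mul_distrib]
      rw [← Fintype.prod_sum (fun j a => Q (u j) a * d1 (u j) a (z j))]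
      exact Finset.prod_le_one (fun j _ => Finset.sum_nonneg fun a _ =>
        mul_nonneg ((hQ _).1 _) (hd1 _ _ _)) (fun j _ => hs1 _ _))
    (fun z => by
      simp_rw [← Finset.prod_mul_distrib]
      rw [← Fintype.prod_sum (fun j u => P u * d2 u (z j))]
      exact Finset.prod_le_one (fun j _ => Finset.sum_nonneg fun a _ =>
        mul_nonneg (hP.1 _) (hd2 _ _)) (fun j _ => hs2 _))
    ((2:ℝ) ^ (N * (L1 - δ/2))) ((2:ℝ) ^ (N * (L2 - δ/2))) (by positivity) (by positivity)
    k1 k2 hk1 hk2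
  refine ⟨f, g1, g2, ?_⟩
  have hexp : ∀ (L k : ℝ), k ≤ (2:ℝ) ^ (N * (L - δ)) → k / (2:ℝ) ^ (N * (L - δ/2))
      ≤ ((2:ℝ) ^ (-(δ/2))) ^ N := by
    intro L k hk
    rw [div_le_iff₀ (by positivity), ← Real.rpow_natCast, ← Real.rpow_mul (by norm_num),
      ← Real.rpow_add (by norm_num)]
    refine hk.trans (le_of_eq ?_)
    congr 1; ring
  have a1 := hC1 N hN0
  have a2 := hC2 N hN0
  have b1 := hexp L1 (k1 - 1) hr1
  have b2 := hexp L2 (k2 - 1) hr2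
  refine le_trans hfg ?_
  linarith

theorem errP1_pad {X Y1 Y2 : Type} [Fintype Y1] [Fintype Y2] [Nonempty X]
    (W : X → Y1 × Y2 → ℝ) (hW : IsChannel W) (n N M : ℕ) (hM : N * n ≤ M) (k1 k2 : ℕ)
    (F : Fin k1 × Fin k2 → Fin N → Fin n → X)
    (g1 : (Fin N → Fin n → Y1) × Fin k2 → Fin k1) (g2 : (Fin N → Fin n → Y2) → Fin k2) :
    ∃ (f' : Fin k1 × Fin k2 → Fin M → X) (g1' : (Fin M → Y1) × Fin k2 → Fin k1)
      (g2' : (Fin M → Y2) → Fin k2),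
      errP1 W M k1 k2 f' g1' g2' = errP1 (nFold W n) N k1 k2 F g1 g2 := by
  set ι : Fin N × Fin n → Fin M := fun k => Fin.castLE hM (finProdFinEquiv k) with hι
  have hinj : Function.Injective ι := by
    intro a b h
    exact finProdFinEquiv.injective (Fin.castLE_injective hM h)
  set f' : Fin k1 × Fin k2 → Fin M → X := fun m i =>
    if h : ∃ k, ι k = i then F m h.choose.1 h.choose.2 else Classical.arbitrary X with hf'
  have hf : ∀ m k, f' m (ι k) = F m k.1 k.2 := by
    intro m k
    have h : ∃ k', ι k' = ι k := ⟨k, rfl⟩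
    simp only [hf']
    rw [dif_pos h, hinj h.choose_spec]
  refine ⟨f', fun yj => g1 (fun a b => yj.1 (ι (a, b)), yj.2),
    fun y => g2 (fun a b => y (ι (a, b))), ?_⟩
  unfold errP1
  congr 1
  refine Finset.sum_congr rfl fun m _ => ?_
  rw [← (Equiv.arrowProdEquivProdArrow (Fin M) (fun _ => Y1) (fun _ => Y2)).sum_comp]
  have := sum_pi_inj (fun i => W (f' m i)) (fun i => (hW _).2) ι hinj
    (fun z => if g1 (fun a b => (z (a, b)).1, m.2) = m.1 ∧ g2 (fun a b => (z (a, b)).2) = m.2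
      then (0:ℝ) else 1)
  refine this.trans ?_
  rw [← (((Equiv.arrowProdEquivProdArrow (Fin N × Fin n) (fun _ => Y1) (fun _ => Y2)).trans
    (Equiv.prodCongr (Equiv.curry (Fin N) (Fin n) Y1)
      (Equiv.curry (Fin N) (Fin n) Y2)))).sum_comp]
  refine Finset.sum_congr rfl fun z _ => ?_
  congr 1
  rw [Fintype.prod_prod_type]
  simp only [hf]
  rfl

theorem Ach1_bound {X Y1 Y2 : Type} [Fintype Y1] [Fintype Y2] [Nonempty X]
    (W : X → Y1 × Y2 → ℝ) (hW : IsChannel W) (R : ℝ × ℝ) (hR : Ach1 W R) :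
    R.1 ≤ Real.logb 2 (Fintype.card Y1) + 1 ∧ R.2 ≤ Real.logb 2 (Fintype.card Y2) + 1 := by
  obtain ⟨_, _, h⟩ := hR
  obtain ⟨n, k1, k2, hn, hk1, hk2, f, g1, g2, h1, h2, he⟩ := h (1/2) (by norm_num)
  have hY : Nonempty (Y1 × Y2) := by
    by_contra hne
    rw [not_nonempty_iff] at hne
    have := (hW (Classical.arbitrary X)).2
    simp at this
  have hY1 : (1:ℝ) ≤ Fintype.card Y1 := by
    have : Nonempty Y1 := ⟨(Classical.arbitrary (Y1 × Y2)).1⟩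
    exact_mod_cast Fintype.card_pos
  have hY2 : (1:ℝ) ≤ Fintype.card Y2 := by
    have : Nonempty Y2 := ⟨(Classical.arbitrary (Y1 × Y2)).2⟩
    exact_mod_cast Fintype.card_pos
  have hkk : (0:ℝ) < (k1:ℝ) * k2 := by positivity
  have hch := nFold_isChannel W hW n
  unfold errP1 at he
  rw [one_div_mul_eq_div, div_le_iff₀ hkk] at he
  -- total mass
  have htot : ∑ m : Fin k1 × Fin k2, ∑ y, nFold W n (f m) y = (k1:ℝ) * k2 := by
    simp [(hch _).2]
  have hcorr1 : (k1:ℝ) * k2 / 2 ≤ ∑ m : Fin k1 × Fin k2, ∑ y, nFold W n (f m) y *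
      (if g1 (y.1, m.2) = m.1 then 1 else 0) := by
    have : (k1:ℝ) * k2 ≤ ∑ m : Fin k1 × Fin k2, ∑ y, nFold W n (f m) y *
      (if g1 (y.1, m.2) = m.1 then 1 else 0) + ∑ m : Fin k1 × Fin k2, ∑ y,
        nFold W n (f m) y * (if g1 (y.1, m.2) = m.1 ∧ g2 y.2 = m.2 then 0 else 1) := by
      rw [← htot, ← Finset.sum_add_distrib]
      refine Finset.sum_le_sum fun m _ => ?_
      rw [← Finset.sum_add_distrib]
      refine Finset.sum_le_sum fun y _ => ?_
      have := (hch (f m)).1 y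
      by_cases c1 : g1 (y.1, m.2) = m.1 <;> by_cases c2 : g2 y.2 = m.2 <;> simp [c1, c2, this]
    linarith
  have hcorr2 : (k1:ℝ) * k2 / 2 ≤ ∑ m : Fin k1 × Fin k2, ∑ y, nFold W n (f m) y *
      (if g2 y.2 = m.2 then 1 else 0) := by
    have : (k1:ℝ) * k2 ≤ ∑ m : Fin k1 × Fin k2, ∑ y, nFold W n (f m) y *
      (if g2 y.2 = m.2 then 1 else 0) + ∑ m : Fin k1 × Fin k2, ∑ y,
        nFold W n (f m) y * (if g1 (y.1, m.2) = m.1 ∧ g2 y.2 = m.2 then 0 else 1) := by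
      rw [← htot, ← Finset.sum_add_distrib]
      refine Finset.sum_le_sum fun m _ => ?_
      rw [← Finset.sum_add_distrib]
      refine Finset.sum_le_sum fun y _ => ?_
      have := (hch (f m)).1 y
      by_cases c1 : g1 (y.1, m.2) = m.1 <;> by_cases c2 : g2 y.2 = m.2 <;> simp [c1, c2, this]
    linarith
  have marg1 : ∀ x y1, ∑ y2, nFold W n x (y1, y2) ≤ 1 := by
    intro x y1
    rw [← (hch x).2, Fintype.sum_prod_type]
    exact Finset.single_le_sum (f := fun y1 => ∑ y2, nFold W n x (y1, y2))
      (fun y1 _ => Finset.sum_nonneg fun y2 _ => (hch x).1 _) (Finset.mem_univ y1)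
  have marg2 : ∀ x y2, ∑ y1, nFold W n x (y1, y2) ≤ 1 := by
    intro x y2
    rw [← (hch x).2, Fintype.sum_prod_type_right]
    exact Finset.single_le_sum (f := fun y2 => ∑ y1, nFold W n x (y1, y2))
      (fun y1 _ => Finset.sum_nonneg fun y2 _ => (hch x).1 _) (Finset.mem_univ y2)
  have up1 : ∑ m : Fin k1 × Fin k2, ∑ y, nFold W n (f m) y *
      (if g1 (y.1, m.2) = m.1 then 1 else 0) ≤ k2 * (Fintype.card Y1 : ℝ) ^ n := by
    calc _ ≤ ∑ m : Fin k1 × Fin k2, ∑ y1 : Fin n → Y1,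
          (if g1 (y1, m.2) = m.1 then (1:ℝ) else 0) := by
          refine Finset.sum_le_sum fun m _ => ?_
          rw [Fintype.sum_prod_type]
          refine Finset.sum_le_sum fun y1 _ => ?_
          refine (le_of_eq (Finset.sum_mul Finset.univ (fun y2 => nFold W n (f m) (y1, y2))
            (if g1 (y1, m.2) = m.1 then (1:ℝ) else 0)).symm).trans ?_
          exact mul_le_of_le_one_left (by split_ifs <;> norm_num) (marg1 _ _)
      _ = k2 * (Fintype.card Y1 : ℝ) ^ n := by
          rw [Finset.sum_comm]
          simp_rw [Fintype.sum_prod_type_right]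
          simp [mul_comm]
  have up2 : ∑ m : Fin k1 × Fin k2, ∑ y, nFold W n (f m) y *
      (if g2 y.2 = m.2 then 1 else 0) ≤ k1 * (Fintype.card Y2 : ℝ) ^ n := by
    calc _ ≤ ∑ m : Fin k1 × Fin k2, ∑ y2 : Fin n → Y2,
          (if g2 y2 = m.2 then (1:ℝ) else 0) := by
          refine Finset.sum_le_sum fun m _ => ?_
          rw [Fintype.sum_prod_type_right]
          refine Finset.sum_le_sum fun y1 _ => ?_
          refine (le_of_eq (Finset.sum_mul Finset.univ (fun y2 => nFold W n (f m) (y2, y1))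
            (if g2 y1 = m.2 then (1:ℝ) else 0)).symm).trans ?_
          exact mul_le_of_le_one_left (by split_ifs <;> norm_num) (marg2 _ _)
      _ = k1 * (Fintype.card Y2 : ℝ) ^ n := by
          rw [Finset.sum_comm]
          simp_rw [Fintype.sum_prod_type]
          simp [mul_comm]
  have fin : ∀ (k c : ℝ), 0 < k → 1 ≤ c → k ≤ 2 * c ^ n →
      Real.logb 2 k / n ≤ Real.logb 2 c + 1 := by
    intro k c hk hc h
    have hn' : (1:ℝ) ≤ n := by exact_mod_cast hn
    rw [div_le_iff₀ (by linarith)]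
    have h3 : Real.logb 2 k ≤ Real.logb 2 (2 * c ^ n) :=
      Real.logb_le_logb_of_le (by norm_num) hk h
    rw [Real.logb_mul (by norm_num) (by positivity), Real.logb_pow,
      Real.logb_self_eq_one (by norm_num)] at h3
    linarith
  have hk1' : (0:ℝ) < k1 := by exact_mod_cast hk1
  have hk2' : (0:ℝ) < k2 := by exact_mod_cast hk2
  refine ⟨h1.trans (fin _ _ hk1' hY1 ?_), h2.trans (fin _ _ hk2' hY2 ?_)⟩
  · have := hcorr1.trans up1
    have h5 : (k2:ℝ) * k1 ≤ k2 * (2 * (Fintype.card Y1 : ℝ) ^ n) := by linarith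
    exact le_of_mul_le_mul_left h5 hk2'
  · have := hcorr2.trans up2
    have h5 : (k1:ℝ) * k2 ≤ k1 * (2 * (Fintype.card Y2 : ℝ) ^ n) := by linarith
    exact le_of_mul_le_mul_left h5 hk1'

theorem Hent_cont {α : Type} [Fintype α] : Continuous (Hent : (α → ℝ) → ℝ) := by
  unfold Hent
  refine Continuous.neg (continuous_finsetSum _ fun a _ => ?_)
  have h : (fun p : α → ℝ => p a * Real.logb 2 (p a))
      = fun p => (p a * Real.log (p a)) / Real.log 2 := by
    funext p; rw [Real.logb]; ring
  rw [h]
  exact (Real.continuous_mul_log.comp (continuous_apply a)).div_const _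

theorem MI_eq {α β : Type} [Fintype α] [Fintype β] (p : α × β → ℝ) (hp : ∀ a, 0 ≤ p a) :
    MI p = ∑ a, p a * Real.logb 2 (p a / ((∑ b, p (a.1, b)) * (∑ x, p (x, a.2)))) := by
  have h : ∀ a, p a * Real.logb 2 (p a / ((∑ b, p (a.1, b)) * (∑ x, p (x, a.2))))
      = p a * Real.logb 2 (p a) - p a * Real.logb 2 (∑ b, p (a.1, b))
        - p a * Real.logb 2 (∑ x, p (x, a.2)) := by
    intro a
    rcases (hp a).eq_or_lt with h0 | h0
    · rw [← h0]; simp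
    · have h1 : 0 < ∑ b, p (a.1, b) := lt_of_lt_of_le h0
        (Finset.single_le_sum (f := fun b => p (a.1, b)) (fun b _ => hp _) (Finset.mem_univ a.2))
      have h2 : 0 < ∑ x, p (x, a.2) := lt_of_lt_of_le h0
        (Finset.single_le_sum (f := fun x => p (x, a.2)) (fun b _ => hp _) (Finset.mem_univ a.1))
      rw [Real.logb_div h0.ne' (mul_pos h1 h2).ne', Real.logb_mul h1.ne' h2.ne']
      ring
  simp_rw [h, Finset.sum_sub_distrib]
  have h1 : ∑ a : α × β, p a * Real.logb 2 (∑ b, p (a.1, b))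
      = ∑ x, (∑ b, p (x, b)) * Real.logb 2 (∑ b, p (x, b)) := by
    rw [Fintype.sum_prod_type]; simp_rw [Finset.sum_mul]
  have h2 : ∑ a : α × β, p a * Real.logb 2 (∑ x, p (x, a.2))
      = ∑ y, (∑ x, p (x, y)) * Real.logb 2 (∑ x, p (x, y)) := by
    rw [Fintype.sum_prod_type_right]; simp_rw [Finset.sum_mul]
  rw [h1, h2, MI, Hent, Hent, Hent]
  ring

theorem CMI_eq {α β γ : Type} [Fintype α] [Fintype β] [Fintype γ] (p : α × β × γ → ℝ)
    (hp : ∀ a, 0 ≤ p a) :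
    CMI p = ∑ a, ∑ b, ∑ c, p (a, b, c) * Real.logb 2 (p (a, b, c) * (∑ a, ∑ b, p (a, b, c))
      / ((∑ b, p (a, b, c)) * (∑ a, p (a, b, c)))) := by
  have h : ∀ a b c, p (a, b, c) * Real.logb 2 (p (a, b, c) * (∑ a, ∑ b, p (a, b, c))
      / ((∑ b, p (a, b, c)) * (∑ a, p (a, b, c))))
      = p (a, b, c) * Real.logb 2 (p (a, b, c))
        + p (a, b, c) * Real.logb 2 (∑ a, ∑ b, p (a, b, c))
        - p (a, b, c) * Real.logb 2 (∑ b, p (a, b, c))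
        - p (a, b, c) * Real.logb 2 (∑ a, p (a, b, c)) := by
    intro a b c
    rcases (hp (a, b, c)).eq_or_lt with h0 | h0
    · rw [← h0]; simp
    · have h1 : 0 < ∑ b, p (a, b, c) := lt_of_lt_of_le h0
        (Finset.single_le_sum (f := fun b => p (a, b, c)) (fun b _ => hp _) (Finset.mem_univ b))
      have h2 : 0 < ∑ a, p (a, b, c) := lt_of_lt_of_le h0
        (Finset.single_le_sum (f := fun a => p (a, b, c)) (fun b _ => hp _) (Finset.mem_univ a))
      have h3 : 0 < ∑ a, ∑ b, p (a, b, c) := lt_of_lt_of_le h1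
        (Finset.single_le_sum (f := fun a => ∑ b, p (a, b, c))
          (fun b _ => Finset.sum_nonneg fun _ _ => hp _) (Finset.mem_univ a))
      rw [Real.logb_div (mul_pos h0 h3).ne' (mul_pos h1 h2).ne', Real.logb_mul h1.ne' h2.ne',
        Real.logb_mul h0.ne' h3.ne']
      ring
  simp_rw [h, Finset.sum_sub_distrib, Finset.sum_add_distrib]
  have h0 : ∑ a, ∑ b, ∑ c, p (a, b, c) * Real.logb 2 (p (a, b, c)) = -Hent p := by
    rw [Hent, Fintype.sum_prod_type]; simp_rw [Fintype.sum_prod_type]; ring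
  have h1 : ∑ a, ∑ b, ∑ c, p (a, b, c) * Real.logb 2 (∑ a, ∑ b, p (a, b, c))
      = -Hent (fun c : γ => ∑ a, ∑ b, p (a, b, c)) := by
    rw [Hent, neg_neg]
    simp_rw [Finset.sum_mul]
    rw [Finset.sum_comm (t := (Finset.univ : Finset α)) (s := (Finset.univ : Finset γ))]
    exact Finset.sum_congr rfl fun a _ => Finset.sum_comm
  have h2 : ∑ a, ∑ b, ∑ c, p (a, b, c) * Real.logb 2 (∑ b, p (a, b, c))
      = -Hent (fun ac : α × γ => ∑ b, p (ac.1, b, ac.2)) := by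
    rw [Hent, neg_neg, Fintype.sum_prod_type]
    simp_rw [Finset.sum_mul]
    exact Finset.sum_congr rfl fun a _ => Finset.sum_comm
  have h3 : ∑ a, ∑ b, ∑ c, p (a, b, c) * Real.logb 2 (∑ a, p (a, b, c))
      = -Hent (fun bc : β × γ => ∑ a, p (a, bc.1, bc.2)) := by
    rw [Hent, neg_neg, Fintype.sum_prod_type]
    simp_rw [Finset.sum_mul]
    rw [Finset.sum_comm]
    exact Finset.sum_congr rfl fun a _ => Finset.sum_comm
  rw [h0, h1, h2, h3, CMI]
  ring

/-- Per-letter joint law of source and a generic reconstruction. -/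
def jGen {S X Y1 Y2 T : Type} [Fintype S] [Fintype Y1] [Fintype Y2]
    (pS : S → ℝ) (W : X → Y1 × Y2 → ℝ) (m n : ℕ)
    (f : (Fin m → S) → Fin n → X) (g : (Fin n → Y1) × (Fin n → Y2) → Fin m → T) (t : Fin m) :
    S × T → ℝ :=
  fun a => ∑ s : Fin m → S, ∑ y : (Fin n → Y1) × (Fin n → Y2),
    srcProd pS m s * nFold W n (f s) y * (if s t = a.1 ∧ g y t = a.2 then 1 else 0)

/-- Time-averaged version of `jGen`. -/
def aGen {S X Y1 Y2 T : Type} [Fintype S] [Fintype Y1] [Fintype Y2]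
    (pS : S → ℝ) (W : X → Y1 × Y2 → ℝ) (m n : ℕ)
    (f : (Fin m → S) → Fin n → X) (g : (Fin n → Y1) × (Fin n → Y2) → Fin m → T) :
    S × T → ℝ :=
  fun a => (1 / (m : ℝ)) * ∑ t, jGen pS W m n f g t a

section Gen

variable {S X Y1 Y2 T : Type} [Fintype S] [Fintype Y1] [Fintype Y2] [Fintype T]
  (pS : S → ℝ) (hpS : IsPMF pS) (W : X → Y1 × Y2 → ℝ) (hW : IsChannel W) (m n : ℕ)
  (f : (Fin m → S) → Fin n → X) (g : (Fin n → Y1) × (Fin n → Y2) → Fin m → T)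

theorem jGen_nonneg (hpS : IsPMF pS) (hW : IsChannel W) (t : Fin m) (a : S × T) :
    0 ≤ jGen pS W m n f g t a :=
  Finset.sum_nonneg fun s _ => Finset.sum_nonneg fun y _ =>
    mul_nonneg (mul_nonneg (Finset.prod_nonneg fun _ _ => hpS.1 _)
      ((nFold_isChannel W hW n _).1 _)) (by split_ifs <;> norm_num)

theorem aGen_nonneg (hpS : IsPMF pS) (hW : IsChannel W) (a : S × T) :
    0 ≤ aGen pS W m n f g a :=
  mul_nonneg (by positivity) (Finset.sum_nonneg fun t _ => jGen_nonneg pS W m n f g hpS hW t a)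

theorem jGen_test (t : Fin m) (ψ : S → T → ℝ) :
    ∑ s, ∑ b, jGen pS W m n f g t (s, b) * ψ s b
      = ∑ s : Fin m → S, ∑ y, srcProd pS m s * nFold W n (f s) y * ψ (s t) (g y t) := by
  simp only [jGen, Finset.sum_mul]
  rw [← Fintype.sum_prod_type' (f := fun s b => ∑ x : Fin m → S, ∑ y,
    srcProd pS m x * nFold W n (f x) y * (if x t = s ∧ g y t = b then 1 else 0) * ψ s b)]
  rw [Finset.sum_comm]
  refine Finset.sum_congr rfl fun s _ => ?_
  rw [Finset.sum_comm]
  refine Finset.sum_congr rfl fun y _ => ?_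
  rw [Fintype.sum_eq_single (s t, g y t)]
  · simp
  · rintro ⟨s', b'⟩ h
    have : ¬ (s t = s' ∧ g y t = b') := fun h' => h (by rw [h'.1, h'.2])
    simp [this]

theorem jGen_marg (hpS : IsPMF pS) (hW : IsChannel W) (t : Fin m) (s : S) :
    ∑ b, jGen pS W m n f g t (s, b) = pS s := by
  have h1 : ∑ s', ∑ b, jGen pS W m n f g t (s', b) * (if s' = s then 1 else 0)
      = ∑ b, jGen pS W m n f g t (s, b) := by
    rw [Fintype.sum_eq_single s]
    · simp
    · intro s' hs'; simp [hs']
  rw [← h1, jGen_test pS W m n f g t (fun s' _ => if s' = s then 1 else 0)]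
  have h2 : ∀ s' : Fin m → S, (∑ y, srcProd pS m s' * nFold W n (f s') y *
      (if s' t = s then 1 else 0)) = (∏ i, pS (s' i)) * (if s' t = s then 1 else 0) := by
    intro s'
    rw [← Finset.sum_mul, ← Finset.mul_sum, (nFold_isChannel W hW n _).2, mul_one]
    rfl
  simp_rw [h2]
  rw [sum_pi_one (fun _ => pS) (fun _ => hpS.2) t (fun a => if a = s then 1 else 0)]
  simp

theorem aGen_marg (hpS : IsPMF pS) (hW : IsChannel W) (hm : 0 < m) (s : S) :
    ∑ b, aGen pS W m n f g (s, b) = pS s := by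
  simp only [aGen]
  rw [← Finset.mul_sum, Finset.sum_comm]
  simp_rw [jGen_marg pS W m n f g hpS hW]
  have : (m:ℝ) ≠ 0 := by positivity
  simp [this]

theorem aGen_pos (hpS : IsPMF pS) (hW : IsChannel W)
    (s : Fin m → S) (y : (Fin n → Y1) × (Fin n → Y2))
    (h : 0 < srcProd pS m s * nFold W n (f s) y) (t : Fin m) :
    0 < aGen pS W m n f g (s t, g y t) := by
  have hm : 0 < m := Fin.pos t
  have h1 : 0 < jGen pS W m n f g t (s t, g y t) := by
    refine lt_of_lt_of_le h ?_
    have hn : ∀ s' y', 0 ≤ srcProd pS m s' * nFold W n (f s') y' *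
        (if s' t = s t ∧ g y' t = g y t then 1 else 0) := fun s' y' =>
      mul_nonneg (mul_nonneg (Finset.prod_nonneg fun _ _ => hpS.1 _)
        ((nFold_isChannel W hW n _).1 _)) (by split_ifs <;> norm_num)
    calc _ = srcProd pS m s * nFold W n (f s) y *
          (if s t = s t ∧ g y t = g y t then 1 else 0) := by simp
      _ ≤ ∑ y', srcProd pS m s * nFold W n (f s) y' *
          (if s t = s t ∧ g y' t = g y t then 1 else 0) :=
          Finset.single_le_sum (f := fun y' => srcProd pS m s * nFold W n (f s) y' *
          (if s t = s t ∧ g y' t = g y t then 1 else 0)) (fun y' _ => hn s y') (Finset.mem_univ y)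
      _ ≤ _ := Finset.single_le_sum (f := fun s' => ∑ y', srcProd pS m s' * nFold W n (f s') y' *
          (if s' t = s t ∧ g y' t = g y t then 1 else 0))
          (fun s' _ => Finset.sum_nonneg fun y' _ => hn s' y') (Finset.mem_univ s)
  have h2 : jGen pS W m n f g t (s t, g y t) ≤ ∑ t', jGen pS W m n f g t' (s t, g y t) :=
    Finset.single_le_sum (f := fun t' => jGen pS W m n f g t' (s t, g y t))
      (fun t' _ => jGen_nonneg pS W m n f g hpS hW t' _) (Finset.mem_univ t)
  exact mul_pos (by positivity) (lt_of_lt_of_le h1 h2)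

/-- Expected block log-score equals `m` times the single-letter averaged score. -/
theorem block_score {U : Type} [Fintype U] (hpS : IsPMF pS) (hW : IsChannel W) (hm : 0 < m)
    (pU : S → U → ℝ) (hpU : IsChannel pU) (P : U → ℝ) (Q : U → S → ℝ)
    (hPQ : ∀ u s, P u * Q u s = pS s * pU s u) (e : U → S → T → ℝ)
    (hpos : ∀ s b u, 0 < aGen pS W m n f g (s, b) * pU s u → 0 < e u s b) :
    (∑ u : Fin m → U, (∏ t, P (u t)) * ∑ a : Fin m → S, (∏ t, Q (u t) (a t)) *
      ∑ z, nFold W n (f a) z * Real.logb 2 (∏ t, e (u t) (a t) (g z t)))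
    = m * ∑ s, ∑ b, aGen pS W m n f g (s, b) * ∑ u, pU s u * Real.logb 2 (e u s b) := by
  have hprod : ∀ (u : Fin m → U) (a : Fin m → S), (∏ t, P (u t)) * (∏ t, Q (u t) (a t))
      = srcProd pS m a * ∏ t, pU (a t) (u t) := by
    intro u a
    rw [srcProd, ← Finset.prod_mul_distrib, ← Finset.prod_mul_distrib]
    exact Finset.prod_congr rfl fun t _ => hPQ _ _
  have h1 : ∀ (u : Fin m → U), (∏ t, P (u t)) * ∑ a : Fin m → S, (∏ t, Q (u t) (a t)) *
      ∑ z, nFold W n (f a) z * Real.logb 2 (∏ t, e (u t) (a t) (g z t))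
      = ∑ a : Fin m → S, ∑ z, ∑ t, srcProd pS m a * nFold W n (f a) z *
        ((∏ t, pU (a t) (u t)) * Real.logb 2 (e (u t) (a t) (g z t))) := by
    intro u
    rw [Finset.mul_sum]
    refine Finset.sum_congr rfl fun a _ => ?_
    rw [← mul_assoc, hprod, Finset.mul_sum]
    refine Finset.sum_congr rfl fun z _ => ?_
    have hn1 : 0 ≤ srcProd pS m a * nFold W n (f a) z := mul_nonneg
      (Finset.prod_nonneg fun _ _ => hpS.1 _) ((nFold_isChannel W hW n _).1 _)
    have hn2 : 0 ≤ ∏ t, pU (a t) (u t) := Finset.prod_nonneg fun t _ => (hpU _).1 _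
    rw [← Finset.mul_sum, ← Finset.mul_sum]
    rcases hn1.eq_or_lt with h0 | h0
    · calc _ = (srcProd pS m a * nFold W n (f a) z) * ((∏ t, pU (a t) (u t)) *
            Real.logb 2 (∏ t, e (u t) (a t) (g z t))) := by ring
        _ = _ := by rw [← h0]; ring
    rcases hn2.eq_or_lt with h0' | h0'
    · rw [← h0']; ring
    have hp : ∀ t, 0 < e (u t) (a t) (g z t) := by
      intro t
      apply hpos
      refine mul_pos (aGen_pos pS W m n f g hpS hW a z h0 t) ?_
      rcases ((hpU (a t)).1 (u t)).eq_or_lt with h2 | h2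
      · exact absurd (Finset.prod_eq_zero (Finset.mem_univ t) h2.symm) h0'.ne'
      · exact h2
    rw [Real.logb_prod _ _ (fun t _ => (hp t).ne')]
    ring
  simp_rw [h1]
  rw [Finset.sum_comm]
  have h2 : ∀ a : Fin m → S, ∑ u : Fin m → U, ∑ z, ∑ t, srcProd pS m a * nFold W n (f a) z *
        ((∏ t, pU (a t) (u t)) * Real.logb 2 (e (u t) (a t) (g z t)))
      = ∑ z, ∑ t, srcProd pS m a * nFold W n (f a) z *
        (∑ u, pU (a t) u * Real.logb 2 (e u (a t) (g z t))) := by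
    intro a
    rw [Finset.sum_comm]
    refine Finset.sum_congr rfl fun z _ => ?_
    rw [Finset.sum_comm]
    refine Finset.sum_congr rfl fun t _ => ?_
    rw [← Finset.mul_sum]
    rw [sum_pi_one (fun t => pU (a t)) (fun t => (hpU _).2) t
      (fun u => Real.logb 2 (e u (a t) (g z t)))]
  simp_rw [h2]
  have h3 : ∀ t, ∑ a : Fin m → S, ∑ z, srcProd pS m a * nFold W n (f a) z *
        (∑ u, pU (a t) u * Real.logb 2 (e u (a t) (g z t)))
      = ∑ s, ∑ b, jGen pS W m n f g t (s, b) * ∑ u, pU s u * Real.logb 2 (e u s b) := fun t =>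
    (jGen_test pS W m n f g t (fun s b => ∑ u, pU s u * Real.logb 2 (e u s b))).symm
  calc _ = ∑ t, ∑ a : Fin m → S, ∑ z, srcProd pS m a * nFold W n (f a) z *
        (∑ u, pU (a t) u * Real.logb 2 (e u (a t) (g z t))) := by
        rw [Finset.sum_comm (s := (Finset.univ : Finset (Fin m)))]
        exact Finset.sum_congr rfl fun a _ => Finset.sum_comm
    _ = ∑ t, ∑ s, ∑ b, jGen pS W m n f g t (s, b) * ∑ u, pU s u * Real.logb 2 (e u s b) :=
        Finset.sum_congr rfl fun t _ => h3 t
    _ = _ := by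
        rw [Finset.sum_comm, Finset.mul_sum]
        refine Finset.sum_congr rfl fun s _ => ?_
        rw [Finset.sum_comm, Finset.mul_sum]
        refine Finset.sum_congr rfl fun b _ => ?_
        rw [← Finset.sum_mul, aGen]
        have : (m:ℝ) ≠ 0 := by positivity
        field_simp

end Gen

theorem code_ach {S X Y1 Y2 US1 US2 : Type} [Fintype S] [Fintype Y1] [Fintype Y2]
    [Fintype US1] [Fintype US2] [Nonempty X]
    (pS : S → ℝ) (hpS : IsPMF pS) (W : X → Y1 × Y2 → ℝ) (hW : IsChannel W) (m n : ℕ) (hm : 0 < m)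
    (f : (Fin m → S) → Fin n → X) (g1 : (Fin n → Y1) → Fin m → US1)
    (g2 : (Fin n → Y2) → Fin m → US2) (k : ℕ) (pU : S → Fin k → ℝ) (hpU : IsChannel pU)
    (κ' δ : ℝ) (hκ' : 0 < κ') (hδ : 0 < δ) (hn : (n:ℝ) / m ≤ κ') (R : ℝ × ℝ)
    (hR1 : 0 ≤ R.1) (hR2 : 0 ≤ R.2)
    (h1 : R.1 ≤ max 0 ((CMI (fun a : S × US1 × Fin k =>
      avgJoint1 pS W m n f g1 (a.1, a.2.1) * pU a.1 a.2.2) - δ) / κ'))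
    (h2 : R.2 ≤ max 0 ((MI (fun a : Fin k × US2 =>
      ∑ s, avgJoint2 pS W m n f g2 (s, a.2) * pU s a.1) - δ) / κ')) :
    Ach1 W R := by
  set a1 : S × US1 → ℝ := avgJoint1 pS W m n f g1 with ha1
  set a2 : S × US2 → ℝ := avgJoint2 pS W m n f g2 with ha2
  have ea1 : a1 = aGen pS W m n f (fun y => g1 y.1) := rfl
  have ea2 : a2 = aGen pS W m n f (fun y => g2 y.2) := rfl
  have na1 : ∀ a, 0 ≤ a1 a := fun a => ea1 ▸ aGen_nonneg pS W m n f _ hpS hW a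
  have na2 : ∀ a, 0 ≤ a2 a := fun a => ea2 ▸ aGen_nonneg pS W m n f _ hpS hW a
  have ma1 : ∀ s, ∑ b, a1 (s, b) = pS s := fun s => ea1 ▸ aGen_marg pS W m n f _ hpS hW hm s
  have ma2 : ∀ s, ∑ b, a2 (s, b) = pS s := fun s => ea2 ▸ aGen_marg pS W m n f _ hpS hW hm s
  set P : Fin k → ℝ := fun u => ∑ s, pS s * pU s u with hPdef
  have hPn : ∀ u, 0 ≤ P u := fun u => Finset.sum_nonneg fun s _ => mul_nonneg (hpS.1 s) ((hpU s).1 u)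
  have hP : IsPMF P := by
    refine ⟨hPn, ?_⟩
    rw [Finset.sum_comm]
    simp only [← Finset.mul_sum, (hpU _).2, mul_one, hpS.2]
  set Q : Fin k → S → ℝ := fun u s => if P u = 0 then pS s else pS s * pU s u / P u with hQdef
  have hQ : IsChannel Q := by
    intro u
    by_cases h : P u = 0
    · simp only [hQdef, h, if_true]; exact hpS
    · simp only [hQdef, h, if_false]
      refine ⟨fun s => div_nonneg (mul_nonneg (hpS.1 s) ((hpU s).1 u)) (hPn u), ?_⟩
      rw [← Finset.sum_div]
      exact div_self h
  have hPQ : ∀ u s, P u * Q u s = pS s * pU s u := by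
    intro u s
    by_cases h : P u = 0
    · have : pS s * pU s u = 0 := (Finset.sum_eq_zero_iff_of_nonneg
        (fun s _ => mul_nonneg (hpS.1 s) ((hpU s).1 u))).1 h s (Finset.mem_univ s)
      rw [h, this, zero_mul]
    · simp only [hQdef, h, if_false]
      field_simp
  -- the joint laws
  set r : S × US1 × Fin k → ℝ := fun a => a1 (a.1, a.2.1) * pU a.1 a.2.2 with hr
  have nr : ∀ a, 0 ≤ r a := fun a => mul_nonneg (na1 _) ((hpU _).1 _)
  have rsu : ∀ s u, ∑ b, r (s, b, u) = pS s * pU s u := by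
    intro s u; simp only [hr]; rw [← Finset.sum_mul, ma1]
  have ru : ∀ u, ∑ s, ∑ b, r (s, b, u) = P u := fun u => by simp only [rsu]; rfl
  set v : Fin k × US2 → ℝ := fun a => ∑ s, a2 (s, a.2) * pU s a.1 with hv
  have nv : ∀ a, 0 ≤ v a := fun a => Finset.sum_nonneg fun s _ => mul_nonneg (na2 _) ((hpU _).1 _)
  have vu : ∀ u, ∑ b, v (u, b) = P u := by
    intro u; simp only [hv]; rw [Finset.sum_comm]
    simp only [← Finset.sum_mul, ma2]; rfl
  set e1 : Fin k → S → US1 → ℝ := fun u s b => r (s, b, u) * (∑ s, ∑ b, r (s, b, u)) /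
    ((∑ b, r (s, b, u)) * (∑ s, r (s, b, u))) with he1
  set e2 : Fin k → US2 → ℝ := fun u b => v (u, b) / ((∑ b, v (u, b)) * (∑ u, v (u, b))) with he2
  have ne1 : ∀ u s b, 0 ≤ e1 u s b := fun u s b => div_nonneg (mul_nonneg (nr _)
    (Finset.sum_nonneg fun _ _ => Finset.sum_nonneg fun _ _ => nr _))
    (mul_nonneg (Finset.sum_nonneg fun _ _ => nr _) (Finset.sum_nonneg fun _ _ => nr _))
  have ne2 : ∀ u b, 0 ≤ e2 u b := fun u b => div_nonneg (nv _)
    (mul_nonneg (Finset.sum_nonneg fun _ _ => nv _) (Finset.sum_nonneg fun _ _ => nv _))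
  have s1 : ∀ u b, ∑ s, Q u s * e1 u s b ≤ 1 := by
    intro u b
    have : ∀ s, Q u s * e1 u s b ≤ r (s, b, u) / ∑ s, r (s, b, u) := by
      intro s
      have hd : 0 ≤ r (s, b, u) / ∑ s, r (s, b, u) :=
        div_nonneg (nr _) (Finset.sum_nonneg fun _ _ => nr _)
      have : Q u s * e1 u s b = ((P u * Q u s) / (pS s * pU s u)) *
          (r (s, b, u) / ∑ s, r (s, b, u)) := by
        simp only [he1, rsu]
        rw [show (∑ s, pS s * pU s u) = P u from rfl]
        rw [div_mul_div_comm, mul_div_assoc']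
        congr 1; ring
      rw [this, hPQ]
      exact mul_le_of_le_one_left hd (div_self_le_one _)
    refine (Finset.sum_le_sum fun s _ => this s).trans ?_
    rw [← Finset.sum_div]
    exact div_self_le_one _
  have s2 : ∀ b, ∑ u, P u * e2 u b ≤ 1 := by
    intro b
    have : ∀ u, P u * e2 u b ≤ v (u, b) / ∑ u, v (u, b) := by
      intro u
      have hd : 0 ≤ v (u, b) / ∑ u, v (u, b) :=
        div_nonneg (nv _) (Finset.sum_nonneg fun _ _ => nv _)
      have : P u * e2 u b = (P u / P u) * (v (u, b) / ∑ u, v (u, b)) := by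
        simp only [he2, vu]
        rw [div_mul_div_comm, mul_div_assoc']
      rw [this]
      exact mul_le_of_le_one_left hd (div_self_le_one _)
    refine (Finset.sum_le_sum fun s _ => this s).trans ?_
    rw [← Finset.sum_div]
    exact div_self_le_one _
  have p1 : ∀ s b u, 0 < a1 (s, b) * pU s u → 0 < e1 u s b := by
    intro s b u h
    have h0 : 0 < r (s, b, u) := h
    have h1 : 0 < ∑ b, r (s, b, u) := lt_of_lt_of_le h0
        (Finset.single_le_sum (f := fun b => r (s, b, u)) (fun b _ => nr _) (Finset.mem_univ b))
    have h2 : 0 < ∑ s, r (s, b, u) := lt_of_lt_of_le h0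
        (Finset.single_le_sum (f := fun a => r (a, b, u)) (fun b _ => nr _) (Finset.mem_univ s))
    have h3 : 0 < ∑ s, ∑ b, r (s, b, u) := lt_of_lt_of_le h1
        (Finset.single_le_sum (f := fun a => ∑ b, r (a, b, u))
          (fun b _ => Finset.sum_nonneg fun _ _ => nr _) (Finset.mem_univ s))
    exact div_pos (mul_pos h0 h3) (mul_pos h1 h2)
  have p2 : ∀ s b u, 0 < a2 (s, b) * pU s u → 0 < e2 u b := by
    intro s b u h
    have h0 : 0 < v (u, b) := lt_of_lt_of_le h
      (Finset.single_le_sum (f := fun s => a2 (s, b) * pU s u)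
        (fun s _ => mul_nonneg (na2 _) ((hpU _).1 _)) (Finset.mem_univ s))
    have h1 : 0 < ∑ b, v (u, b) := lt_of_lt_of_le h0
        (Finset.single_le_sum (f := fun b => v (u, b)) (fun b _ => nv _) (Finset.mem_univ b))
    have h2 : 0 < ∑ u, v (u, b) := lt_of_lt_of_le h0
        (Finset.single_le_sum (f := fun a => v (a, b)) (fun b _ => nv _) (Finset.mem_univ u))
    exact div_pos h0 (mul_pos h1 h2)
  have I1 : CMI r = ∑ s, ∑ b, a1 (s, b) * ∑ u, pU s u * Real.logb 2 (e1 u s b) := by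
    rw [CMI_eq r nr]
    refine Finset.sum_congr rfl fun s _ => Finset.sum_congr rfl fun b _ => ?_
    rw [Finset.mul_sum]
    refine Finset.sum_congr rfl fun u _ => ?_
    rw [← mul_assoc]
  have I2 : MI v = ∑ s, ∑ b, a2 (s, b) * ∑ u, pU s u * Real.logb 2 (e2 u b) := by
    rw [MI_eq v nv, Fintype.sum_prod_type]
    have : ∀ u b, v (u, b) * Real.logb 2 (v (u, b) / ((∑ b, v (u, b)) * (∑ x, v (x, b))))
        = ∑ s, a2 (s, b) * (pU s u * Real.logb 2 (e2 u b)) := by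
      intro u b
      rw [show v (u, b) = ∑ s, a2 (s, b) * pU s u from rfl, Finset.sum_mul]
      exact Finset.sum_congr rfl fun s _ => by rw [mul_assoc]
    refine (Finset.sum_congr rfl fun u _ => Finset.sum_congr rfl fun b _ => this u b).trans ?_
    simp only [Finset.mul_sum]
    rw [Finset.sum_comm]
    rw [Finset.sum_comm (s := (Finset.univ : Finset S))]
    refine Finset.sum_congr rfl fun b _ => Finset.sum_comm
  have L1 := block_score pS W m n f (fun y => g1 y.1) hpS hW hm pU hpU P Q hPQ e1 p1
  have L2 := block_score pS W m n f (fun y => g2 y.2) hpS hW hm pU hpU P Q hPQ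
    (fun u _ b => e2 u b) p2
  rw [← ea1, ← I1] at L1
  rw [← ea2, ← I2] at L2
  have pos : ∀ (u : Fin m → Fin k) (a : Fin m → S) (z : (Fin n → Y1) × (Fin n → Y2)),
      0 < (∏ t, P (u t)) * ((∏ t, Q (u t) (a t)) * nFold W n (f a) z) →
      0 < srcProd pS m a * nFold W n (f a) z ∧ ∀ t, 0 < pU (a t) (u t) := by
    intro u a z h
    rw [← mul_assoc, ← Finset.prod_mul_distrib] at h
    simp only [hPQ, Finset.prod_mul_distrib] at h
    have n1 : 0 ≤ ∏ t, pS (a t) := Finset.prod_nonneg fun _ _ => hpS.1 _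
    have n2 : 0 ≤ ∏ t, pU (a t) (u t) := Finset.prod_nonneg fun t _ => (hpU _).1 _
    have n3 := (nFold_isChannel W hW n (f a)).1 z
    have c1 : 0 < ∏ t, pS (a t) := by
      rcases n1.eq_or_lt with h0 | h0
      · rw [← h0] at h; simp at h
      · exact h0
    have c2 : 0 < ∏ t, pU (a t) (u t) := by
      rcases n2.eq_or_lt with h0 | h0
      · rw [← h0] at h; simp at h
      · exact h0
    have c3 : 0 < nFold W n (f a) z := by
      rcases n3.eq_or_lt with h0 | h0
      · rw [← h0] at h; simp at h
      · exact h0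
    refine ⟨mul_pos c1 c3, fun t => ?_⟩
    rcases ((hpU (a t)).1 (u t)).eq_or_lt with h2 | h2
    · exact absurd (Finset.prod_eq_zero (Finset.mem_univ t) h2.symm) c2.ne'
    · exact h2
  refine ⟨hR1, hR2, fun ε hε => ?_⟩
  have hm' : (0:ℝ) < m := by exact_mod_cast hm
  have hcode := iid_code (fun u : Fin m → Fin k => ∏ t, P (u t))
    ⟨fun u => Finset.prod_nonneg fun j _ => hP.1 _, sum_pi_all (fun _ => P) (fun _ => hP.2)⟩
    (fun u (a : Fin m → S) => ∏ j, Q (u j) (a j))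
    (fun u => ⟨fun a => Finset.prod_nonneg fun j _ => (hQ _).1 _,
      sum_pi_all (fun j => Q (u j)) (fun j => (hQ _).2)⟩)
    (fun a => nFold W n (f a)) (fun a => nFold_isChannel W hW n (f a))
    (fun u a z => ∏ t, e1 (u t) (a t) (g1 z t)) (fun u z => ∏ t, e2 (u t) (g2 z t))
    (fun u a z => Finset.prod_nonneg fun j _ => ne1 _ _ _)
    (fun u z => Finset.prod_nonneg fun j _ => ne2 _ _)
    (fun u z => by
      simp_rw [← Finset.prod_mul_distrib]
      rw [← Fintype.prod_sum (fun j a => Q (u j) a * e1 (u j) a (g1 z j))]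
      exact Finset.prod_le_one (fun j _ => Finset.sum_nonneg fun a _ =>
        mul_nonneg ((hQ _).1 _) (ne1 _ _ _)) (fun j _ => s1 _ _))
    (fun z => by
      simp_rw [← Finset.prod_mul_distrib]
      rw [← Fintype.prod_sum (fun j u => P u * e2 u (g2 z j))]
      exact Finset.prod_le_one (fun j _ => Finset.sum_nonneg fun a _ =>
        mul_nonneg (hP.1 _) (ne2 _ _)) (fun j _ => s2 _))
    (fun u a z h => Finset.prod_pos fun t _ => by
      obtain ⟨q1, q2⟩ := pos u a z h
      exact p1 _ _ _ (mul_pos (aGen_pos pS W m n f (fun y => g1 y.1) hpS hW a z q1 t) (q2 t)))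
    (fun u a z h => Finset.prod_pos fun t _ => by
      obtain ⟨q1, q2⟩ := pos u a z h
      exact p2 _ _ _ (mul_pos (aGen_pos pS W m n f (fun y => g2 y.2) hpS hW a z q1 t) (q2 t)))
    (m * CMI r) (m * MI v) L1.symm L2.symm (m * (δ/2)) ε (by positivity) hε
  have hev1 : ∀ᶠ N : ℕ in Filter.atTop, CMI r - δ ≤ m * κ' * (δ/2) * N :=
    (tendsto_natCast_atTop_atTop.const_mul_atTop
      (show 0 < m * κ' * (δ/2) by positivity)).eventually_ge_atTop _
  have hev2 : ∀ᶠ N : ℕ in Filter.atTop, MI v - δ ≤ m * κ' * (δ/2) * N :=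
    (tendsto_natCast_atTop_atTop.const_mul_atTop
      (show 0 < m * κ' * (δ/2) by positivity)).eventually_ge_atTop _
  obtain ⟨N, hN, hN1, hN2, hN0⟩ := (hcode.and (hev1.and (hev2.and
    (Filter.eventually_gt_atTop 0)))).exists
  have hN0' : (0:ℝ) < N := by exact_mod_cast hN0
  set M := ⌈κ' * m * N⌉₊ with hM
  have hMl : κ' * m * N ≤ M := Nat.le_ceil _
  have hMu : (M:ℝ) ≤ κ' * m * N + 1 := (Nat.ceil_lt_add_one (by positivity)).le
  have hMpos : 0 < M := Nat.ceil_pos.2 (by positivity)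
  have hMn : N * n ≤ M := by
    have h3 : (n:ℝ) ≤ κ' * m := (div_le_iff₀ hm').1 hn
    have : (N:ℝ) * n ≤ M := by nlinarith
    exact_mod_cast this
  set k1 := ⌊(2:ℝ) ^ (N * (m * CMI r - m * (δ/2)))⌋₊ + 1 with hk1
  set k2 := ⌊(2:ℝ) ^ (N * (m * MI v - m * (δ/2)))⌋₊ + 1 with hk2
  obtain ⟨F, G1, G2, hFG⟩ := hN k1 k2 (Nat.succ_pos _) (Nat.succ_pos _)
    (by rw [hk1]; push_cast; rw [add_sub_cancel_right]; exact Nat.floor_le (by positivity))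
    (by rw [hk2]; push_cast; rw [add_sub_cancel_right]; exact Nat.floor_le (by positivity))
  obtain ⟨f', g1', g2', hp⟩ := errP1_pad W hW n N M hMn k1 k2 (fun m j => f (F m j)) G1 G2
  have rate : ∀ (I R : ℝ) (K : ℕ), I - δ ≤ m * κ' * (δ/2) * N → R ≤ max 0 ((I - δ) / κ') →
      K = ⌊(2:ℝ) ^ (N * (m * I - m * (δ/2)))⌋₊ + 1 → R ≤ Real.logb 2 K / M := by
    intro I R K hI hR hK
    have hM' : (0:ℝ) < M := by exact_mod_cast hMpos
    have hK1 : (1:ℝ) ≤ K := by rw [hK]; push_cast; linarith [Nat.cast_nonneg (α := ℝ) ⌊(2:ℝ) ^ (N * (m * I - m * (δ/2)))⌋₊]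
    have hK2 : N * (m * I - m * (δ/2)) ≤ Real.logb 2 K := by
      rw [Real.le_logb_iff_rpow_le (by norm_num) (by linarith), hK]
      push_cast
      exact (Nat.lt_floor_add_one _).le
    refine hR.trans (max_le ?_ ?_)
    · exact div_nonneg (Real.logb_nonneg (by norm_num) hK1) hM'.le
    · by_cases hs : I - δ ≤ 0
      · exact (div_nonpos_of_nonpos_of_nonneg hs hκ'.le).trans
          (div_nonneg (Real.logb_nonneg (by norm_num) hK1) hM'.le)
      · push Not at hs
        rw [div_le_div_iff₀ hκ' hM']
        have t1 : (I - δ) * M ≤ (I - δ) * (κ' * m * N + 1) := mul_le_mul_of_nonneg_left hMu hs.le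
        have t2 : N * (m * I - m * (δ/2)) * κ' ≤ Real.logb 2 K * κ' :=
          mul_le_mul_of_nonneg_right hK2 hκ'.le
        nlinarith
  exact ⟨M, k1, k2, hMpos, Nat.succ_pos _, Nat.succ_pos _, f', g1', g2',
    rate _ _ _ hN1 h1 hk1, rate _ _ _ hN2 h2 hk2, hp.le.trans hFG⟩

theorem MI_cont {α β : Type} [Fintype α] [Fintype β] : Continuous (MI : (α × β → ℝ) → ℝ) := by
  unfold MI
  refine (Continuous.add (Hent_cont.comp ?_) (Hent_cont.comp ?_)).sub Hent_cont
  · fun_prop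
  · fun_prop

theorem CMI_cont {α β γ : Type} [Fintype α] [Fintype β] [Fintype γ] :
    Continuous (CMI : (α × β × γ → ℝ) → ℝ) := by
  unfold CMI
  refine (((Hent_cont.comp ?_).add (Hent_cont.comp ?_)).sub Hent_cont).sub (Hent_cont.comp ?_)
  · fun_prop
  · fun_prop
  · fun_prop

theorem tendsto_of_l1dist {α : Type} [Fintype α] (p : ℕ → α → ℝ) (q : α → ℝ)
    (h : Filter.Tendsto (fun j => l1dist (p j) q) Filter.atTop (nhds 0)) :
    Filter.Tendsto p Filter.atTop (nhds q) := by
  rw [tendsto_pi_nhds]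
  intro a
  rw [tendsto_iff_dist_tendsto_zero]
  refine squeeze_zero (fun _ => dist_nonneg) (fun j => ?_) h
  rw [Real.dist_eq]
  exact Finset.single_le_sum (f := fun a => |p j a - q a|) (fun _ _ => abs_nonneg _)
    (Finset.mem_univ a)

theorem l1dist_nonneg {α : Type} [Fintype α] (p q : α → ℝ) : 0 ≤ l1dist p q :=
  Finset.sum_nonneg fun _ _ => abs_nonneg _

theorem l1dist_tri {α : Type} [Fintype α] (p q r : α → ℝ) :
    l1dist p r ≤ l1dist p q + l1dist q r := by
  unfold l1dist
  rw [← Finset.sum_add_distrib]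
  exact Finset.sum_le_sum fun a _ => abs_sub_le _ _ _

theorem core1 {S X Y1 Y2 US1 US2 : Type} [Fintype S] [Fintype Y1] [Fintype Y2]
    [Fintype US1] [Fintype US2] [Nonempty X]
    (pS : S → ℝ) (hpS : IsPMF pS) (W : X → Y1 × Y2 → ℝ) (hW : IsChannel W)
    (κ : ℝ) (hκ : 0 ≤ κ) (q1 : S × US1 → ℝ) (q2 : S × US2 → ℝ)
    (hG : InGamma pS W {q1} {q2} κ) (k : ℕ) (pU : S → Fin k → ℝ) (hpU : IsChannel pU)
    (R : ℝ × ℝ) (hR1 : 0 ≤ R.1) (hR2 : 0 ≤ R.2)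
    (h1 : R.1 ≤ CMI (fun a : S × US1 × Fin k => q1 (a.1, a.2.1) * pU a.1 a.2.2))
    (h2 : R.2 ≤ MI (fun a : Fin k × US2 => ∑ s, q2 (s, a.2) * pU s a.1)) :
    R ∈ scaleSet κ (Cap1 W) := by
  set ε : ℕ → ℝ := fun j => 1 / ((j:ℝ) + 1) with hε
  have εpos : ∀ j, 0 < ε j := fun j => Nat.one_div_pos_of_nat
  have εlim : Filter.Tendsto ε Filter.atTop (nhds 0) := tendsto_one_div_add_atTop_nhds_zero_nat
  have hG' := fun j => hG (ε j) (εpos j)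
  choose m n hm f g1 g2 hn he1 he2 using hG'
  have he1' : ∀ j, l1dist (avgJoint1 pS W (m j) (n j) (f j) (g1 j)) q1 ≤ ε j := by
    intro j; obtain ⟨q, hq, h⟩ := he1 j; rw [Set.mem_singleton_iff] at hq; rwa [hq] at h
  have he2' : ∀ j, l1dist (avgJoint2 pS W (m j) (n j) (f j) (g2 j)) q2 ≤ ε j := by
    intro j; obtain ⟨q, hq, h⟩ := he2 j; rw [Set.mem_singleton_iff] at hq; rwa [hq] at h
  have t1 := tendsto_of_l1dist (fun j => avgJoint1 pS W (m j) (n j) (f j) (g1 j)) q1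
    (squeeze_zero (fun _ => l1dist_nonneg _ _) he1' εlim)
  have t2 := tendsto_of_l1dist (fun j => avgJoint2 pS W (m j) (n j) (f j) (g2 j)) q2
    (squeeze_zero (fun _ => l1dist_nonneg _ _) he2' εlim)
  have c1 : Continuous (fun q : S × US1 → ℝ =>
      CMI (fun a : S × US1 × Fin k => q (a.1, a.2.1) * pU a.1 a.2.2)) :=
    CMI_cont.comp (by fun_prop)
  have c2 : Continuous (fun q : S × US2 → ℝ =>
      MI (fun a : Fin k × US2 => ∑ s, q (s, a.2) * pU s a.1)) :=
    MI_cont.comp (by fun_prop)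
  have T1 := (c1.tendsto q1).comp t1
  have T2 := (c2.tendsto q2).comp t2
  set I1 : ℕ → ℝ := _ with hI1
  change Filter.Tendsto I1 _ _ at T1
  set I2 : ℕ → ℝ := (fun q : S × US2 → ℝ =>
      MI (fun a : Fin k × US2 => ∑ s, q (s, a.2) * pU s a.1)) ∘
      (fun j => avgJoint2 pS W (m j) (n j) (f j) (g2 j)) with hI2
  have κpos : ∀ j, 0 < κ + ε j := fun j => add_pos_of_nonneg_of_pos hκ (εpos j)
  set r : ℕ → ℝ × ℝ := fun j => (max 0 ((min R.1 (I1 j) - ε j) / (κ + ε j)),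
    max 0 ((min R.2 (I2 j) - ε j) / (κ + ε j))) with hr
  have ach : ∀ j, Ach1 W (r j) := by
    intro j
    refine code_ach pS hpS W hW (m j) (n j) (hm j) (f j) (g1 j) (g2 j) k pU hpU (κ + ε j) (ε j)
      (κpos j) (εpos j) (hn j) (r j) (le_max_left _ _) (le_max_left _ _) ?_ ?_
    · exact max_le_max le_rfl (div_le_div_of_nonneg_right
        (sub_le_sub_right (min_le_right _ _) _) (κpos j).le)
    · exact max_le_max le_rfl (div_le_div_of_nonneg_right
        (sub_le_sub_right (min_le_right _ _) _) (κpos j).le)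
  have gen : ∀ (ρ I : ℝ) (J : ℕ → ℝ), 0 ≤ ρ → ρ ≤ I → Filter.Tendsto J Filter.atTop (nhds I) →
      Filter.Tendsto (fun j => min ρ (J j) - ε j) Filter.atTop (nhds ρ) := by
    intro ρ I J h0 hI hJ
    have := (tendsto_const_nhds (x := ρ)).min hJ |>.sub εlim
    rwa [min_eq_left hI, sub_zero] at this
  have G1 := gen _ _ _ hR1 h1 T1
  have G2 := gen _ _ _ hR2 h2 T2
  have κlim : Filter.Tendsto (fun j => κ + ε j) Filter.atTop (nhds κ) := by
    simpa using εlim.const_add κ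
  rcases hκ.eq_or_lt with h0 | h0
  · -- zero bandwidth
    have fin : ∀ (ρ C : ℝ) (J x : ℕ → ℝ), 0 ≤ ρ → Filter.Tendsto J Filter.atTop (nhds ρ) →
        (∀ j, J j / (κ + ε j) ≤ C) → ρ = 0 := by
      intro ρ C J x hρ hJ hb
      refine le_antisymm ?_ hρ
      have hz : Filter.Tendsto (fun j => C * (κ + ε j)) Filter.atTop (nhds (C * κ)) :=
        κlim.const_mul C
      rw [← h0, mul_zero] at hz
      refine le_of_tendsto_of_tendsto' hJ (by simpa [← h0] using hz) fun j => ?_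
      have := hb j
      rw [div_le_iff₀ (κpos j)] at this
      simpa [← h0] using this
    have z1 : R.1 = 0 := fin R.1 _ _ (fun _ => 0) hR1 G1
      (fun j => (le_max_right _ _).trans (Ach1_bound W hW _ (ach j)).1)
    have z2 : R.2 = 0 := fin R.2 _ _ (fun _ => 0) hR2 G2
      (fun j => (le_max_right _ _).trans (Ach1_bound W hW _ (ach j)).2)
    refine ⟨r 0, subset_closure (ach 0), ?_⟩
    simp only [← h0, zero_mul]
    exact Prod.ext z1.symm z2.symm
  · refine ⟨(R.1 / κ, R.2 / κ), ?_, ?_⟩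
    · refine mem_closure_of_tendsto (f := r) (b := Filter.atTop) ?_
        (Filter.Eventually.of_forall ach)
      refine Filter.Tendsto.prodMk_nhds ?_ ?_
      · have := (tendsto_const_nhds (x := (0:ℝ))).max (G1.div κlim h0.ne')
        rwa [max_eq_right (div_nonneg hR1 hκ)] at this
      · have := (tendsto_const_nhds (x := (0:ℝ))).max (G2.div κlim h0.ne')
        rwa [max_eq_right (div_nonneg hR2 hκ)] at this
    · exact Prod.ext (mul_div_cancel₀ _ h0.ne') (mul_div_cancel₀ _ h0.ne')

theorem gamma_point {S X Y1 Y2 US1 US2 : Type} [Fintype S] [Fintype Y1] [Fintype Y2]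
    [Fintype US1] [Fintype US2]
    (pS : S → ℝ) (W : X → Y1 × Y2 → ℝ) (κ : ℝ)
    (Q1 : Set (S × US1 → ℝ)) (Q2 : Set (S × US2 → ℝ))
    (hQ1c : IsCompact Q1) (hQ2c : IsCompact Q2) (hach : InGamma pS W Q1 Q2 κ) :
    ∃ q1 ∈ Q1, ∃ q2 ∈ Q2, InGamma pS W {q1} {q2} κ := by
  set ε : ℕ → ℝ := fun j => 1 / ((j:ℝ) + 1) with hε
  have εpos : ∀ j, 0 < ε j := fun j => Nat.one_div_pos_of_nat
  have εlim : Filter.Tendsto ε Filter.atTop (nhds 0) := tendsto_one_div_add_atTop_nhds_zero_nat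
  have hG' := fun j => hach (ε j) (εpos j)
  choose m n hm f g1 g2 hn H1 H2 using hG'
  choose a1 ha1 he1 using H1
  choose a2 ha2 he2 using H2
  obtain ⟨⟨q1, q2⟩, hq, φ, hφ, hlim⟩ := (hQ1c.prod hQ2c).tendsto_subseq
    (x := fun j => (a1 j, a2 j)) (fun j => ⟨ha1 j, ha2 j⟩)
  refine ⟨q1, hq.1, q2, hq.2, fun e he => ?_⟩
  have εl : Filter.Tendsto (fun j => ε (φ j)) Filter.atTop (nhds 0) := εlim.comp hφ.tendsto_atTop
  have hl1 : Filter.Tendsto (fun j => a1 (φ j)) Filter.atTop (nhds q1) :=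
    (continuous_fst.tendsto _).comp hlim
  have hl2 : Filter.Tendsto (fun j => a2 (φ j)) Filter.atTop (nhds q2) :=
    (continuous_snd.tendsto _).comp hlim
  have cl1 : Continuous (fun q => l1dist q q1) := by unfold l1dist; fun_prop
  have cl2 : Continuous (fun q => l1dist q q2) := by unfold l1dist; fun_prop
  have hd1 : Filter.Tendsto (fun j => l1dist (a1 (φ j)) q1) Filter.atTop (nhds 0) := by
    have := (cl1.tendsto q1).comp hl1
    simpa [l1dist, Function.comp_def] using this
  have hd2 : Filter.Tendsto (fun j => l1dist (a2 (φ j)) q2) Filter.atTop (nhds 0) := by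
    have := (cl2.tendsto q2).comp hl2
    simpa [l1dist, Function.comp_def] using this
  have he2' : (0:ℝ) < e / 2 := by linarith
  obtain ⟨j, hj1, hj2, hj3⟩ := ((εl.eventually_lt_const he2').and
    ((hd1.eventually_lt_const he2').and (hd2.eventually_lt_const he2'))).exists
  refine ⟨m (φ j), n (φ j), hm _, f _, g1 _, g2 _, ?_, ⟨q1, rfl, ?_⟩, ⟨q2, rfl, ?_⟩⟩
  · have := hn (φ j); linarith
  · have := l1dist_tri (avgJoint1 pS W (m (φ j)) (n (φ j)) (f (φ j)) (g1 (φ j))) (a1 (φ j)) q1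
    have := he1 (φ j); linarith
  · have := l1dist_tri (avgJoint2 pS W (m (φ j)) (n (φ j)) (f (φ j)) (g2 (φ j))) (a2 (φ j)) q2
    have := he2 (φ j); linarith

/-- The broadcast channel with the two receivers exchanged. -/
def swapW {X Y1 Y2 : Type} (W : X → Y1 × Y2 → ℝ) : X → Y2 × Y1 → ℝ := fun x y => W x (y.2, y.1)

theorem swapW_channel {X Y1 Y2 : Type} [Fintype Y1] [Fintype Y2]
    (W : X → Y1 × Y2 → ℝ) (hW : IsChannel W) : IsChannel (swapW W) := by
  intro x
  refine ⟨fun y => (hW x).1 _, ?_⟩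
  rw [← (hW x).2]
  exact (Equiv.prodComm Y2 Y1).sum_comp (fun y => W x y)

theorem gamma_swap {S X Y1 Y2 US1 US2 : Type} [Fintype S] [Fintype Y1] [Fintype Y2]
    [Fintype US1] [Fintype US2]
    (pS : S → ℝ) (W : X → Y1 × Y2 → ℝ) (κ : ℝ)
    (Q1 : Set (S × US1 → ℝ)) (Q2 : Set (S × US2 → ℝ))
    (hach : InGamma pS W Q1 Q2 κ) : InGamma pS (swapW W) Q2 Q1 κ := by
  intro ε hε
  obtain ⟨m, n, hm, f, g1, g2, hn, h1, h2⟩ := hach ε hε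
  refine ⟨m, n, hm, f, g2, g1, hn, ?_, ?_⟩
  · have : avgJoint1 pS (swapW W) m n f g2 = avgJoint2 pS W m n f g2 := by
      funext a
      unfold avgJoint1 avgJoint2 jointPi1 jointPi2
      congr 1
      refine Finset.sum_congr rfl fun t _ => Finset.sum_congr rfl fun s _ => ?_
      exact (Equiv.prodComm (Fin n → Y2) (Fin n → Y1)).sum_comp (fun y =>
        srcProd pS m s * nFold W n (f s) y * (if s t = a.1 ∧ g2 y.2 t = a.2 then 1 else 0))
    rw [this]; exact h2
  · have : avgJoint2 pS (swapW W) m n f g1 = avgJoint1 pS W m n f g1 := by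
      funext a
      unfold avgJoint1 avgJoint2 jointPi1 jointPi2
      congr 1
      refine Finset.sum_congr rfl fun t _ => Finset.sum_congr rfl fun s _ => ?_
      exact (Equiv.prodComm (Fin n → Y2) (Fin n → Y1)).sum_comp (fun y =>
        srcProd pS m s * nFold W n (f s) y * (if s t = a.1 ∧ g1 y.1 t = a.2 then 1 else 0))
    rw [this]; exact h1

theorem ach_swap {X Y1 Y2 : Type} [Fintype Y1] [Fintype Y2]
    (W : X → Y1 × Y2 → ℝ) (R : ℝ × ℝ) (h : Ach1 (swapW W) R) : Ach2 W R.swap := by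
  obtain ⟨h1, h2, h⟩ := h
  refine ⟨h2, h1, fun ε hε => ?_⟩
  obtain ⟨n, k1, k2, hn, hk1, hk2, f, g1, g2, e1, e2, he⟩ := h ε hε
  refine ⟨n, k2, k1, hn, hk2, hk1, fun m => f m.swap, g2, g1, e2, e1, ?_⟩
  refine le_of_eq_of_le ?_ he
  unfold errP1 errP2
  rw [mul_comm (k2:ℝ)]
  congr 1
  refine Fintype.sum_equiv (Equiv.prodComm _ _) _ _ fun m => ?_
  refine Fintype.sum_equiv (Equiv.prodComm _ _) _ _ fun y => ?_
  simp only [Equiv.prodComm_apply, Prod.fst_swap, Prod.snd_swap, and_comm]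
  rfl

theorem scale_swap {X Y1 Y2 : Type} [Fintype Y1] [Fintype Y2]
    (W : X → Y1 × Y2 → ℝ) (κ : ℝ) (R : ℝ × ℝ) (h : R.swap ∈ scaleSet κ (Cap1 (swapW W))) :
    R ∈ scaleSet κ (Cap2 W) := by
  obtain ⟨r, hr, e⟩ := h
  refine ⟨r.swap, map_mem_closure continuous_swap hr (fun x hx => ach_swap W x hx), ?_⟩
  have := congrArg Prod.swap e
  simpa using this

/-- **Theorem 2 (necessary condition for the source broadcast problem).**
For any `(κ,𝒬₁,𝒬₂) ∈ Γ` there exists a joint pmf `p_{S,Ŝ1,Ŝ2}` with `𝒮`-marginal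
`p_S` and `p_{S,Ŝᵢ} ∈ 𝒬ᵢ` such that `ℛᵢ(p_{S,Ŝ1,Ŝ2}) ⊆ κ𝒞ᵢ(p_{Y1,Y2|X})`, `i = 1,2`. -/
theorem sourceBroadcast_necessary
    {S X Y1 Y2 US1 US2 : Type}
    [Fintype S] [Fintype X] [Fintype Y1] [Fintype Y2] [Fintype US1] [Fintype US2]
    [Nonempty S] [Nonempty X] [Nonempty US1] [Nonempty US2]
    (pS : S → ℝ) (hpS : IsPMF pS)
    (W : X → Y1 × Y2 → ℝ) (hW : IsChannel W)
    (κ : ℝ) (hκ : 0 ≤ κ)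
    (Q1 : Set (S × US1 → ℝ)) (Q2 : Set (S × US2 → ℝ))
    (hQ1ne : Q1.Nonempty) (hQ1c : IsCompact Q1)
    (hQ1m : ∀ q ∈ Q1, IsPMF q ∧ ∀ s, ∑ u, q (s, u) = pS s)
    (hQ2ne : Q2.Nonempty) (hQ2c : IsCompact Q2)
    (hQ2m : ∀ q ∈ Q2, IsPMF q ∧ ∀ s, ∑ u, q (s, u) = pS s)
    (hach : InGamma pS W Q1 Q2 κ) :
    ∃ p : S × US1 × US2 → ℝ, IsPMF p ∧
      (∀ s, ∑ u1, ∑ u2, p (s, u1, u2) = pS s) ∧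
      (fun a : S × US1 => ∑ u2, p (a.1, a.2, u2)) ∈ Q1 ∧
      (fun a : S × US2 => ∑ u1, p (a.1, u1, a.2)) ∈ Q2 ∧
      Rreg1 p ⊆ scaleSet κ (Cap1 W) ∧
      Rreg2 p ⊆ scaleSet κ (Cap2 W) := by
  obtain ⟨q1, hq1, q2, hq2, hG⟩ := gamma_point pS W κ Q1 Q2 hQ1c hQ2c hach
  obtain ⟨⟨n1, _⟩, m1⟩ := hQ1m q1 hq1
  obtain ⟨⟨n2, _⟩, m2⟩ := hQ2m q2 hq2
  have z1 : ∀ s, pS s = 0 → ∀ u, q1 (s, u) = 0 := fun s h u =>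
    (Finset.sum_eq_zero_iff_of_nonneg (fun u _ => n1 (s, u))).1 ((m1 s).trans h) u
      (Finset.mem_univ u)
  have z2 : ∀ s, pS s = 0 → ∀ u, q2 (s, u) = 0 := fun s h u =>
    (Finset.sum_eq_zero_iff_of_nonneg (fun u _ => n2 (s, u))).1 ((m2 s).trans h) u
      (Finset.mem_univ u)
  set p : S × US1 × US2 → ℝ := fun a => q1 (a.1, a.2.1) * q2 (a.1, a.2.2) / pS a.1 with hp
  have M1 : ∀ s u1, ∑ u2, p (s, u1, u2) = q1 (s, u1) := by
    intro s u1
    simp only [hp]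
    rw [← Finset.sum_div, ← Finset.mul_sum, m2]
    by_cases h : pS s = 0
    · simp [h, z1 s h]
    · field_simp
  have M2 : ∀ s u2, ∑ u1, p (s, u1, u2) = q2 (s, u2) := by
    intro s u2
    simp only [hp]
    rw [← Finset.sum_div, ← Finset.sum_mul, m1]
    by_cases h : pS s = 0
    · simp [h, z2 s h]
    · field_simp
  have M0 : ∀ s, ∑ u1, ∑ u2, p (s, u1, u2) = pS s := by
    intro s; simp only [M1, m1]
  refine ⟨p, ⟨fun a => div_nonneg (mul_nonneg (n1 _) (n2 _)) (hpS.1 _), ?_⟩, M0, ?_, ?_, ?_, ?_⟩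
  · simp only [Fintype.sum_prod_type, M0]
    exact hpS.2
  · simp only [M1]; exact hq1
  · simp only [M2]; exact hq2
  · rintro R ⟨hR1, hR2, k, pU, hpU, h1, h2⟩
    simp only [M1] at h1
    simp only [← Finset.sum_mul, M2] at h2
    exact core1 pS hpS W hW κ hκ q1 q2 hG k pU hpU R hR1 hR2 h1 h2
  · rintro R ⟨hR1, hR2, k, pU, hpU, h1, h2⟩
    simp only [M2] at h2
    simp only [← Finset.sum_mul, M1] at h1
    exact scale_swap W κ R (core1 pS hpS (swapW W) (swapW_channel W hW) κ hκ q2 q1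
      (gamma_swap pS W κ _ _ hG) k pU hpU R.swap hR2 hR1 h2 h1)


end
end

section
/- Let S be uniformly distributed on {0,1} and let p_{S,Ŝ1,Ŝ2} be a joint pmf on {0,1}³ with S-marginal uniform. (i) If Pr{S ≠ Ŝ_i} ≤ d_i for i=1,2 with d_1 ≤ d_2 ≤ 1/2, then ℛ₁(p_{S,Ŝ1,Ŝ2}) ⊇ 𝒞(BS-BC(d_1,d_2)) and ℛ₂(p_{S,Ŝ1,Ŝ2}) ⊇ 𝒞̃(BS-BC(d_1,d_2)). (ii) If moreover for i=1,2 the conditional law of Ŝ_i given S is that of a binary symmetric channel with crossover probability d_i (with d_1 ≤ d_2), then ℛ₁(p_{S,Ŝ1,Ŝ2}) = 𝒞(BS-BC(d_1,d_2)) and ℛ₂(p_{S,Ŝ1,Ŝ2}) = 𝒞̃(BS-BC(d_1,d_2)). -/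
open scoped BigOperators Classical
open Finset

noncomputable section

/-- The region `𝒞̃(BS-BC(d₁,d₂))`. -/
def CtBSBC (d1 d2 : ℝ) : Set (ℝ × ℝ) :=
  {R | 0 ≤ R.1 ∧ 0 ≤ R.2 ∧ ∃ β ∈ Set.Icc (0:ℝ) 1,
    R.1 ≤ β * (1 - Hb d1) ∧ R.2 ≤ (1 - β) * (1 - Hb d2)}

/-- The odd function `log (1+w) - log (1-w)`, twice the inverse hyperbolic tangent. -/
def LL (w : ℝ) : ℝ := Real.log (1 + w) - Real.log (1 - w)

/-- Binary entropy (nats) in the symmetric parametrization. -/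
def GG (w : ℝ) : ℝ := Real.binEntropy ((1 - w) / 2)

lemma LL_hasDeriv {w : ℝ} (h0 : -1 < w) (h1 : w < 1) : HasDerivAt LL (2 / (1 - w ^ 2)) w := by
  have a : HasDerivAt (fun w : ℝ => 1 + w) 1 w := (hasDerivAt_id w).const_add 1
  have b : HasDerivAt (fun w : ℝ => 1 - w) (-1) w := by
    simpa using (hasDerivAt_id w).const_sub 1
  have h2 : 1 + w ≠ 0 := by linarith
  have h3 : 1 - w ≠ 0 := by linarith
  have h4 : 1 - w ^ 2 ≠ 0 := by
    have : 1 - w ^ 2 = (1 + w) * (1 - w) := by ring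
    rw [this]; exact mul_ne_zero h2 h3
  have := (a.log h2).sub (b.log h3)
  refine HasDerivAt.congr_deriv this ?_
  field_simp
  ring

lemma LL_zero : LL 0 = 0 := by simp [LL]

lemma LL_ge {w : ℝ} (h0 : 0 ≤ w) (h1 : w < 1) : 2 * w ≤ LL w := by
  have h := Real.hasSum_log_sub_log_of_abs_lt_one (x := w) (by rw [abs_of_nonneg h0]; exact h1)
  have := h.summable.sum_le_tsum {0} (fun i _ => by positivity)
  rw [h.tsum_eq] at this
  simpa [LL] using this

lemma LL_nonneg {w : ℝ} (h0 : 0 ≤ w) (h1 : w < 1) : 0 ≤ LL w := by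
  have := LL_ge h0 h1; linarith

lemma LL_scale {c w : ℝ} (hc : 0 ≤ c) (hc1 : c ≤ 1) (h0 : 0 ≤ w) (h1 : w < 1) :
    LL (c * w) ≤ c * LL w := by
  have hcw : c * w ≤ w := by nlinarith
  have hcw0 : 0 ≤ c * w := by positivity
  have h := Real.hasSum_log_sub_log_of_abs_lt_one (x := w) (by rw [abs_of_nonneg h0]; exact h1)
  have h' := Real.hasSum_log_sub_log_of_abs_lt_one (x := c * w)
    (by rw [abs_of_nonneg hcw0]; linarith)
  refine hasSum_le (fun k => ?_) h' (h.mul_left c)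
  rw [mul_pow]
  have : c ^ (2 * k + 1) ≤ c := by
    rw [pow_succ]
    exact mul_le_of_le_one_left hc (pow_le_one₀ hc hc1)
  have hw : 0 ≤ 2 * (1 / (2 * (k:ℝ) + 1)) * w ^ (2 * k + 1) := by positivity
  nlinarith

lemma psi_anti : AntitoneOn (fun w : ℝ => (1 - w ^ 2) * LL w / w) (Set.Ioo 0 1) := by
  have hd : ∀ w ∈ Set.Ioo (0:ℝ) 1, HasDerivAt (fun w : ℝ => (1 - w ^ 2) * LL w / w)
      ((2 * w - (1 + w ^ 2) * LL w) / w ^ 2) w := by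
    rintro w ⟨h0, h1⟩
    have a : HasDerivAt (fun w : ℝ => 1 - w ^ 2) (-(2 * w)) w := by
      simpa using (hasDerivAt_pow 2 w).const_sub 1
    have := (a.mul (LL_hasDeriv (by linarith) h1)).div (hasDerivAt_id w) h0.ne'
    refine HasDerivAt.congr_deriv this ?_
    have h4 : 1 - w ^ 2 ≠ 0 := by nlinarith
    simp only [id, Pi.mul_apply]
    field_simp
    ring
  refine antitoneOn_of_deriv_nonpos (convex_Ioo 0 1)
    (fun w hw => (hd w hw).continuousAt.continuousWithinAt) ?_ ?_
  · rw [interior_Ioo]; exact fun w hw => (hd w hw).differentiableAt.differentiableWithinAt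
  · rw [interior_Ioo]
    intro w hw
    rw [(hd w hw).deriv]
    have := LL_ge hw.1.le hw.2
    apply div_nonpos_of_nonpos_of_nonneg _ (sq_nonneg _)
    nlinarith [sq_nonneg w, hw.1, mul_nonneg (sq_nonneg w) (LL_nonneg hw.1.le hw.2)]

lemma ratio_anti {c : ℝ} (hc : 0 < c) (hc1 : c ≤ 1) :
    AntitoneOn (fun w : ℝ => LL (c * w) / LL w) (Set.Ioo 0 1) := by
  have hpos : ∀ w ∈ Set.Ioo (0:ℝ) 1, 0 < LL w := fun w hw => by
    have := LL_ge hw.1.le hw.2; linarith [hw.1]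
  have hcw : ∀ w ∈ Set.Ioo (0:ℝ) 1, c * w ∈ Set.Ioo (0:ℝ) 1 := fun w hw =>
    ⟨mul_pos hc hw.1, by nlinarith [hw.1, hw.2]⟩
  have hd : ∀ w ∈ Set.Ioo (0:ℝ) 1, HasDerivAt (fun w : ℝ => LL (c * w) / LL w)
      ((2 / (1 - (c * w) ^ 2) * c * LL w - LL (c * w) * (2 / (1 - w ^ 2))) / LL w ^ 2) w := by
    intro w hw
    have a : HasDerivAt (fun w : ℝ => c * w) c w := by
      simpa using (hasDerivAt_id w).const_mul c
    have b : HasDerivAt (fun w : ℝ => LL (c * w)) (2 / (1 - (c * w) ^ 2) * c) w :=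
      HasDerivAt.comp w (LL_hasDeriv (by linarith [(hcw w hw).1]) (hcw w hw).2) a
    exact b.div (LL_hasDeriv (by linarith [hw.1]) hw.2) (hpos w hw).ne'
  refine antitoneOn_of_deriv_nonpos (convex_Ioo 0 1)
    (fun w hw => (hd w hw).continuousAt.continuousWithinAt) ?_ ?_
  · rw [interior_Ioo]; exact fun w hw => (hd w hw).differentiableAt.differentiableWithinAt
  · rw [interior_Ioo]
    intro w hw
    rw [(hd w hw).deriv]
    apply div_nonpos_of_nonpos_of_nonneg _ (sq_nonneg _)
    have h := psi_anti (hcw w hw) hw (by nlinarith [hw.1])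
    simp only at h
    rw [div_le_div_iff₀ hw.1 (hcw w hw).1] at h
    have h1 : 0 < 1 - w ^ 2 := by nlinarith [hw.1, hw.2]
    have h2 : 0 < 1 - (c * w) ^ 2 := by nlinarith [(hcw w hw).1, (hcw w hw).2]
    have h3 : c * ((1 - w ^ 2) * LL w) ≤ (1 - (c * w) ^ 2) * LL (c * w) := by
      have := hw.1
      nlinarith
    rw [sub_nonpos, div_mul_eq_mul_div, div_mul_eq_mul_div, mul_div_assoc', div_le_div_iff₀ h2 h1]
    nlinarith

lemma GG_hasDeriv {w : ℝ} (h0 : -1 < w) (h1 : w < 1) : HasDerivAt GG (-(LL w) / 2) w := by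
  have a : HasDerivAt (fun w : ℝ => (1 - w) / 2) (-1 / 2) w := by
    simpa using ((hasDerivAt_id w).const_sub 1).div_const 2
  have b := Real.hasDerivAt_binEntropy (p := (1 - w) / 2) (by intro h; linarith)
    (by intro h; linarith)
  have := HasDerivAt.comp w b a
  refine HasDerivAt.congr_deriv this ?_
  have e1 : 1 - (1 - w) / 2 = (1 + w) / 2 := by ring
  rw [e1, Real.log_div (by linarith) (by norm_num), Real.log_div (by linarith) (by norm_num), LL]
  ring

lemma GG_cont : Continuous GG := by unfold GG; fun_prop

lemma GG_zero : GG 0 = Real.log 2 := by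
  unfold GG; rw [show ((1:ℝ) - 0) / 2 = 2⁻¹ by norm_num]; simp

lemma GG_neg (w : ℝ) : GG (-w) = GG w := by
  unfold GG; rw [← Real.binEntropy_one_sub]; congr 1; ring

lemma GG_abs (w : ℝ) : GG |w| = GG w := by
  rcases abs_choice w with h | h <;> rw [h]; exact GG_neg w

lemma GG_le (w : ℝ) : GG w ≤ Real.log 2 := Real.binEntropy_le_log_two

lemma GG_anti : AntitoneOn GG (Set.Icc 0 1) := by
  intro x hx y hy hxy
  apply Real.binEntropy_strictMonoOn.monotoneOn
  · constructor <;> linarith [hy.1, hy.2]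
  · constructor <;> linarith [hx.1, hx.2]
  · linarith

/-- Tangent form of Mrs. Gerber's lemma. -/
lemma gerber {c : ℝ} (hc : 0 ≤ c) (hc1 : c ≤ 1) {w0 : ℝ} (hw0 : w0 ∈ Set.Icc (0:ℝ) 1) :
    ∃ l : ℝ, ∀ w ∈ Set.Icc (0:ℝ) 1, GG (c * w0) + l * (GG w - GG w0) ≤ GG (c * w) := by
  rcases hc.eq_or_lt with rfl | hc
  · exact ⟨0, by simp⟩
  have hcw : ∀ w ∈ Set.Ioo (0:ℝ) 1, c * w ∈ Set.Ioo (0:ℝ) 1 := fun w hw =>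
    ⟨mul_pos hc hw.1, by nlinarith [hw.1, hw.2]⟩
  have hpos : ∀ w ∈ Set.Ioo (0:ℝ) 1, 0 < LL w := fun w hw => by
    have := LL_ge hw.1.le hw.2; linarith [hw.1]
  have hd : ∀ l : ℝ, ∀ w ∈ Set.Ioo (0:ℝ) 1, HasDerivAt (fun w : ℝ => GG (c * w) - l * GG w)
      ((l * LL w - c * LL (c * w)) / 2) w := by
    intro l w hw
    have a : HasDerivAt (fun w : ℝ => c * w) c w := by
      simpa using (hasDerivAt_id w).const_mul c
    have b : HasDerivAt (fun w : ℝ => GG (c * w)) (-(LL (c * w)) / 2 * c) w :=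
      HasDerivAt.comp (h₂ := GG) w (GG_hasDeriv (by linarith [(hcw w hw).1]) (hcw w hw).2) a
    have := b.sub ((GG_hasDeriv (w := w) (by linarith [hw.1]) hw.2).const_mul l)
    refine HasDerivAt.congr_deriv this ?_
    ring
  have hcont : ∀ l : ℝ, Continuous (fun w : ℝ => GG (c * w) - l * GG w) := fun l =>
    (GG_cont.comp (continuous_const.mul continuous_id)).sub (continuous_const.mul GG_cont)
  rcases hw0.2.eq_or_lt with rfl | h1
  · refine ⟨0, fun w hw => ?_⟩
    have := GG_anti (a := c * w) (b := c * 1) ⟨mul_nonneg hc.le hw.1, by nlinarith [hw.1, hw.2]⟩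
      ⟨by linarith, by linarith⟩ (by nlinarith [hw.2])
    linarith
  rcases hw0.1.eq_or_lt with rfl | h0
  · refine ⟨c ^ 2, fun w hw => ?_⟩
    have hm : MonotoneOn (fun w : ℝ => GG (c * w) - c ^ 2 * GG w) (Set.Icc 0 1) := by
      refine monotoneOn_of_deriv_nonneg (convex_Icc 0 1) (hcont _).continuousOn ?_ ?_
      · rw [interior_Icc]
        exact fun w hw => (hd _ w hw).differentiableAt.differentiableWithinAt
      · rw [interior_Icc]
        intro w hw
        rw [(hd _ w hw).deriv]
        have := LL_scale hc.le hc1 hw.1.le hw.2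
        nlinarith
    have := hm ⟨le_refl _, zero_le_one⟩ hw hw.1
    simp only at this
    linarith
  · have hw0' : w0 ∈ Set.Ioo (0:ℝ) 1 := ⟨h0, h1⟩
    refine ⟨c * (LL (c * w0) / LL w0), fun w hw => ?_⟩
    set l := c * (LL (c * w0) / LL w0) with hl
    rcases le_total w w0 with hle | hle
    · have hm : AntitoneOn (fun w : ℝ => GG (c * w) - l * GG w) (Set.Icc 0 w0) := by
        refine antitoneOn_of_deriv_nonpos (convex_Icc 0 w0) (hcont _).continuousOn ?_ ?_
        · rw [interior_Icc]
          exact fun w hw => (hd _ w ⟨hw.1, by linarith [hw.2]⟩).differentiableAt.differentiableWithinAt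
        · rw [interior_Icc]
          intro w hw
          have hw' : w ∈ Set.Ioo (0:ℝ) 1 := ⟨hw.1, by linarith [hw.2]⟩
          rw [(hd _ w hw').deriv]
          have := ratio_anti hc hc1 hw' hw0' hw.2.le
          simp only at this
          rw [le_div_iff₀ (hpos w hw')] at this
          rw [hl]
          nlinarith
      have := hm ⟨hw.1, hle⟩ ⟨h0.le, le_refl _⟩ hle
      simp only at this
      linarith
    · have hm : MonotoneOn (fun w : ℝ => GG (c * w) - l * GG w) (Set.Icc w0 1) := by
        refine monotoneOn_of_deriv_nonneg (convex_Icc w0 1) (hcont _).continuousOn ?_ ?_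
        · rw [interior_Icc]
          exact fun w hw => (hd _ w ⟨by linarith [hw.1], hw.2⟩).differentiableAt.differentiableWithinAt
        · rw [interior_Icc]
          intro w hw
          have hw' : w ∈ Set.Ioo (0:ℝ) 1 := ⟨by linarith [hw.1], hw.2⟩
          rw [(hd _ w hw').deriv]
          have := ratio_anti hc hc1 hw0' hw' hw.1.le
          simp only at this
          rw [div_le_iff₀ (hpos w hw')] at this
          rw [hl]
          nlinarith
      have := hm ⟨le_refl _, h1.le⟩ ⟨hle, hw.2⟩ hle
      simp only at this
      linarith

/-- Consequence of concavity: the ratio inequality used for the second converse. -/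
lemma gerber_ratio {c : ℝ} (hc : 0 ≤ c) (hc1 : c ≤ 1) {w v : ℝ} (hw : w ∈ Set.Icc (0:ℝ) 1)
    (hv : v ∈ Set.Icc (0:ℝ) 1) :
    v ≤ w → (Real.log 2 - GG v) * (Real.log 2 - GG (c * w)) ≤
      (Real.log 2 - GG (c * v)) * (Real.log 2 - GG w) := by
  intro hvw
  obtain ⟨l, hl⟩ := gerber hc hc1 hv
  have h1 := hl w hw
  have h2 := hl 0 ⟨le_refl _, zero_le_one⟩
  rw [mul_zero, GG_zero] at h2
  have h3 := GG_le v
  have h4 := GG_anti hv hw hvw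
  nlinarith [mul_le_mul_of_nonneg_left h1 (sub_nonneg.2 h3),
    mul_le_mul_of_nonneg_left h2 (sub_nonneg.2 h4)]

/-- The unnormalized two-point entropy. -/
def KK (x y : ℝ) : ℝ := Real.negMulLog x + Real.negMulLog y - Real.negMulLog (x + y)

lemma KK_comm (x y : ℝ) : KK x y = KK y x := by
  unfold KK; rw [add_comm y x]; ring

lemma KK_smul (c x y : ℝ) : KK (c * x) (c * y) = c * KK x y := by
  unfold KK
  rw [← mul_add, Real.negMulLog_mul, Real.negMulLog_mul, Real.negMulLog_mul]
  ring

lemma KK_one (x : ℝ) : KK x (1 - x) = Real.binEntropy x := by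
  unfold KK
  rw [Real.binEntropy_eq_negMulLog_add_negMulLog_one_sub]; simp

lemma KK_one' (x y : ℝ) (h : x + y = 1) : KK x y = Real.binEntropy x := by
  rw [← KK_one]; congr 1; linarith

lemma KK_scaled (P x : ℝ) : KK (P * x) (P * (1 - x)) = P * Real.binEntropy x := by
  rw [KK_smul, KK_one]

lemma KK_super {x y x' y' : ℝ} (hx : 0 ≤ x) (hy : 0 ≤ y) (hx' : 0 ≤ x') (hy' : 0 ≤ y') :
    KK x y + KK x' y' ≤ KK (x + x') (y + y') := by
  have hz : KK 0 0 = 0 := by simp [KK]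
  rcases (add_nonneg hx hy).eq_or_lt with h | hP
  · obtain rfl : x = 0 := by linarith
    obtain rfl : y = 0 := by linarith
    simp [hz]
  rcases (add_nonneg hx' hy').eq_or_lt with h | hP'
  · obtain rfl : x' = 0 := by linarith
    obtain rfl : y' = 0 := by linarith
    simp [hz]
  have key : ∀ a b : ℝ, 0 < a + b → KK a b = (a + b) * Real.binEntropy (a / (a + b)) := by
    intro a b h
    rw [← KK_scaled]
    congr 1 <;> field_simp
    ring
  rw [key x y hP, key x' y' hP', key _ _ (by linarith)]
  have hm1 : x / (x + y) ∈ Set.Icc (0:ℝ) 1 := ⟨by positivity, by rw [div_le_one hP]; linarith⟩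
  have hm2 : x' / (x' + y') ∈ Set.Icc (0:ℝ) 1 := ⟨by positivity, by rw [div_le_one hP']; linarith⟩
  have hw1 : 0 ≤ (x + y) / (x + x' + (y + y')) := by positivity
  have hw2 : 0 ≤ (x' + y') / (x + x' + (y + y')) := by positivity
  have hc := Real.strictConcave_binEntropy.concaveOn.2 hm1 hm2 hw1 hw2
    (by rw [← add_div, div_eq_one_iff_eq (by linarith)]; ring)
  simp only [smul_eq_mul] at hc
  have hT : 0 < x + x' + (y + y') := by linarith
  have e : (x + y) / (x + x' + (y + y')) * (x / (x + y)) +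
      (x' + y') / (x + x' + (y + y')) * (x' / (x' + y')) = (x + x') / (x + x' + (y + y')) := by
    field_simp
  rw [e] at hc
  have := mul_le_mul_of_nonneg_left hc hT.le
  refine le_trans (le_of_eq ?_) this
  field_simp

lemma log2_pos : 0 < Real.log 2 := Real.log_pos (by norm_num)

lemma Hent_eq {α : Type} [Fintype α] (p : α → ℝ) :
    Hent p * Real.log 2 = ∑ a, Real.negMulLog (p a) := by
  unfold Hent Real.negMulLog Real.logb
  rw [neg_mul, Finset.sum_mul, ← Finset.sum_neg_distrib]
  refine Finset.sum_congr rfl fun a _ => ?_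
  have := log2_pos.ne'
  field_simp

lemma Hb_eq (x : ℝ) : Hb x * Real.log 2 = Real.binEntropy x := by
  unfold Hb Real.logb
  rw [Real.binEntropy_eq_negMulLog_add_negMulLog_one_sub]
  unfold Real.negMulLog
  have := log2_pos.ne'
  field_simp
  ring

lemma eta_half : Real.negMulLog (1 / 2) = Real.log 2 / 2 := by
  unfold Real.negMulLog
  rw [one_div, Real.log_inv]; ring

/-- Unnormalized joint law of the auxiliary and the reproduction. -/
def VV {k : ℕ} (q : Bool → Bool → ℝ) (t : Bool → Fin k → ℝ) (y : Bool) (u : Fin k) : ℝ :=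
  q true y * t true u + q false y * t false u

lemma CMI_eq_s10 {k : ℕ} (q : Bool → Bool → ℝ) (t : Bool → Fin k → ℝ)
    (hq : ∀ s, q s true + q s false = 1 / 2) (ht : ∀ s, ∑ u, t s u = 1) :
    CMI (fun a : Bool × Bool × Fin k => q a.1 a.2.1 * t a.1 a.2.2) * Real.log 2 =
      Real.log 2 - (Real.negMulLog (q true true) + Real.negMulLog (q true false) +
        Real.negMulLog (q false true) + Real.negMulLog (q false false)) +
      ∑ u, KK (VV q t true u) (VV q t false u) := by
  unfold CMI
  rw [sub_mul, sub_mul, add_mul, Hent_eq, Hent_eq, Hent_eq, Hent_eq]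
  simp only [Fintype.sum_prod_type, Fintype.sum_bool, KK, VV]
  simp only [← add_mul, hq, Real.negMulLog_mul, Finset.sum_add_distrib, Finset.sum_sub_distrib,
    ← Finset.mul_sum, ← Finset.sum_mul, ht, eta_half]
  have e : ∀ u, q true true * t true u + q false true * t false u +
      (q true false * t true u + q false false * t false u) =
      1 / 2 * t true u + 1 / 2 * t false u := fun u => by
    linear_combination t true u * hq true + t false u * hq false
  simp only [e]
  have h1 := hq true
  have h2 := hq false
  have g1 : q true false = 1 / 2 - q true true := by linarith
  have g2 : q false false = 1 / 2 - q false true := by linarith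
  rw [g1, g2]
  ring

lemma MI_eq_s10 {k : ℕ} (q : Bool → Bool → ℝ) (t : Bool → Fin k → ℝ) (ht : ∀ s, ∑ u, t s u = 1) :
    MI (fun a : Fin k × Bool => VV q t a.2 a.1) * Real.log 2 =
      Real.negMulLog (q true true + q false true) + Real.negMulLog (q true false + q false false) -
      ∑ u, KK (VV q t true u) (VV q t false u) := by
  unfold MI
  rw [sub_mul, add_mul, Hent_eq, Hent_eq, Hent_eq]
  simp only [Fintype.sum_prod_type, Fintype.sum_bool, KK]
  have e : ∀ y, ∑ u, VV q t y u = q true y + q false y := fun y => by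
    simp only [VV, Finset.sum_add_distrib, ← Finset.mul_sum, ht, mul_one]
  simp only [e, Finset.sum_add_distrib, Finset.sum_sub_distrib]
  ring

lemma hmono {x y : ℝ} (hx : 0 ≤ x) (hxy : x ≤ y) (hy : y ≤ 1 / 2) :
    Real.binEntropy x ≤ Real.binEntropy y :=
  Real.binEntropy_strictMonoOn.monotoneOn ⟨hx, by norm_num; linarith⟩
    ⟨by linarith, by norm_num; linarith⟩ hxy

/-- Two-letter functional used for the symmetrization argument. -/
def MM (α x y : ℝ) : ℝ := KK (x * (1 - α)) (y * α) + KK (x * α) (y * (1 - α))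

lemma MM_comm (α x y : ℝ) : MM α x y = MM α y x := by
  unfold MM; rw [KK_comm (x * (1 - α)), KK_comm (x * α)]; ring

lemma MM_smul (α c x y : ℝ) : MM α (c * x) (c * y) = c * MM α x y := by
  unfold MM; simp only [mul_assoc, KK_smul]; ring

lemma MM_super {α x y x' y' : ℝ} (h0 : 0 ≤ α) (h1 : α ≤ 1)
    (hx : 0 ≤ x) (hy : 0 ≤ y) (hx' : 0 ≤ x') (hy' : 0 ≤ y') :
    MM α x y + MM α x' y' ≤ MM α (x + x') (y + y') := by
  have h2 : 0 ≤ 1 - α := by linarith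
  have a := KK_super (mul_nonneg hx h2) (mul_nonneg hy h0) (mul_nonneg hx' h2) (mul_nonneg hy' h0)
  have b := KK_super (mul_nonneg hx h0) (mul_nonneg hy h2) (mul_nonneg hx' h0) (mul_nonneg hy' h2)
  unfold MM
  simp only [add_mul] at *
  linarith

lemma MM_mono {α m d : ℝ} (h0 : 0 ≤ α) (h1 : α ≤ 1) (hm : 0 ≤ m) (hmd : m ≤ d) (hd : d ≤ 1 / 2) :
    MM α (1 - m) m ≤ MM α (1 - d) d := by
  obtain ⟨θ, hθ0, hθ1, hθ⟩ : ∃ θ : ℝ, 0 ≤ θ ∧ θ ≤ 1 ∧ d = θ * m + (1 - θ) * (1 - m) := by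
    rcases (hmd.trans hd).eq_or_lt with h | h
    · exact ⟨1, by norm_num, by norm_num, by linarith⟩
    · have h3 : 0 < 1 - 2 * m := by linarith
      refine ⟨(1 - m - d) / (1 - 2 * m), div_nonneg (by linarith) h3.le, ?_, ?_⟩
      · rw [div_le_one h3]; linarith
      · have h4 : (1 - m - d) / (1 - 2 * m) * (1 - 2 * m) = 1 - m - d := div_mul_cancel₀ _ h3.ne'
        linear_combination h4
  have a := MM_smul α θ (1 - m) m
  have b := MM_smul α (1 - θ) m (1 - m)
  rw [MM_comm α m] at b
  have h2 : 0 ≤ 1 - θ := by linarith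
  have h3 : 0 ≤ 1 - m := by linarith
  have c := MM_super h0 h1 (mul_nonneg hθ0 h3) (mul_nonneg hθ0 hm) (mul_nonneg h2 hm)
    (mul_nonneg h2 h3)
  have e1 : θ * (1 - m) + (1 - θ) * m = 1 - d := by rw [hθ]; ring
  rw [e1, ← hθ] at c
  linarith

lemma MM_val (α d : ℝ) : MM α (1 - d) d =
    Real.binEntropy α + Real.binEntropy d - Real.binEntropy (bconv α d) := by
  unfold MM KK
  have e1 : (1 - d) * (1 - α) + d * α = 1 - bconv α d := by unfold bconv; ring
  have e2 : (1 - d) * α + d * (1 - α) = bconv α d := by unfold bconv; ring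
  rw [e1, e2]
  simp only [Real.negMulLog_mul, Real.binEntropy_eq_negMulLog_add_negMulLog_one_sub]
  ring

/-- The binary symmetric test channel. -/
def tB (α : ℝ) (s : Bool) : Fin 2 → ℝ := ![if s then 1 - α else α, if s then α else 1 - α]

/-- The erasure test channel. -/
def tE (β : ℝ) (s : Bool) : Fin 3 → ℝ := ![if s then β else 0, if s then 0 else β, 1 - β]

lemma tB_sum (α : ℝ) (s : Bool) : ∑ u, tB α s u = 1 := by
  cases s <;> simp [tB, Fin.sum_univ_two]

lemma tE_sum (β : ℝ) (s : Bool) : ∑ u, tE β s u = 1 := by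
  cases s <;> simp [tE, Fin.sum_univ_three]

lemma tB_nonneg {α : ℝ} (h0 : 0 ≤ α) (h1 : α ≤ 1) (s : Bool) (u : Fin 2) : 0 ≤ tB α s u := by
  fin_cases u <;> cases s <;> simp [tB, h0, h1]

lemma tE_nonneg {α : ℝ} (h0 : 0 ≤ α) (h1 : α ≤ 1) (s : Bool) (u : Fin 3) : 0 ≤ tE α s u := by
  fin_cases u <;> cases s <;> simp [tE, h0, h1]

lemma CMI_tB {α d : ℝ} (h0 : 0 ≤ α) (h1 : α ≤ 1) (q : Bool → Bool → ℝ) (hn : ∀ s y, 0 ≤ q s y)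
    (hq : ∀ s, q s true + q s false = 1 / 2) (he : q true false + q false true ≤ d)
    (hd : d ≤ 1 / 2) :
    Real.binEntropy (bconv α d) - Real.binEntropy d ≤
    CMI (fun a : Bool × Bool × Fin 2 => q a.1 a.2.1 * tB α a.1 a.2.2) * Real.log 2 := by
  rw [CMI_eq_s10 q _ hq (tB_sum α)]
  have key : Real.log 2 - (Real.negMulLog (q true true) + Real.negMulLog (q true false) +
        Real.negMulLog (q false true) + Real.negMulLog (q false false)) +
      ∑ u, KK (VV q (tB α) true u) (VV q (tB α) false u) =
      Real.binEntropy α - (MM α (q true true) (q false true) +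
        MM α (q true false) (q false false)) := by
    simp only [Fin.sum_univ_two, VV, tB, MM, KK]
    simp only [Bool.false_eq_true, if_true, if_false, Matrix.cons_val_zero, Matrix.cons_val_one]
    have e1 : q true true * (1 - α) + q false true * α +
      (q true false * (1 - α) + q false false * α) = 1 / 2 := by
      linear_combination (1 - α) * hq true + α * hq false
    have e2 : q true true * α + q false true * (1 - α) +
      (q true false * α + q false false * (1 - α)) = 1 / 2 := by
      linear_combination α * hq true + (1 - α) * hq false
    rw [e1, e2, eta_half]
    simp only [Real.negMulLog_mul, Real.binEntropy_eq_negMulLog_add_negMulLog_one_sub]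
    linear_combination (Real.negMulLog α + Real.negMulLog (1 - α)) * (hq true + hq false)
  rw [key]
  have a := MM_super h0 h1 (hn true true) (hn false true) (hn false false) (hn true false)
  rw [MM_comm α (q false false)] at a
  have b := MM_mono h0 h1 (add_nonneg (hn true false) (hn false true)) he hd
  have e1 : q true true + q false false = 1 - (q true false + q false true) := by
    linarith [hq true, hq false]
  rw [e1, add_comm (q false true)] at a
  rw [MM_val α d] at b
  linarith

lemma fano2 {a b c e d : ℝ} (ha : 0 ≤ a) (hb : 0 ≤ b) (hc : 0 ≤ c) (he : 0 ≤ e)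
    (hs : a + b + c + e = 1) (hd : b + c ≤ d) (hd2 : d ≤ 1 / 2) :
    KK a b + KK c e ≤ Real.binEntropy d := by
  have h := KK_super ha hb he hc
  rw [KK_comm e c, KK_comm (a + e), KK_one' (b + c) _ (by linarith)] at h
  have := hmono (add_nonneg hb hc) hd hd2
  linarith

lemma bconv_le {α m d : ℝ} (h1 : α ≤ 1 / 2) (hmd : m ≤ d) : bconv α m ≤ bconv α d := by
  unfold bconv; nlinarith

lemma MI_tB {α d : ℝ} (h0 : 0 ≤ α) (h1 : α ≤ 1 / 2) (q : Bool → Bool → ℝ)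
    (hn : ∀ s y, 0 ≤ q s y)
    (hq : ∀ s, q s true + q s false = 1 / 2) (he : q true false + q false true ≤ d)
    (hd : d ≤ 1 / 2) :
    Real.log 2 - Real.binEntropy (bconv α d) ≤
    MI (fun a : Fin 2 × Bool => VV q (tB α) a.2 a.1) * Real.log 2 := by
  rw [MI_eq_s10 q _ (tB_sum α)]
  have hV : ∀ y u, 0 ≤ VV q (tB α) y u := fun y u =>
    add_nonneg (mul_nonneg (hn _ _) (tB_nonneg h0 (by linarith) _ _))
      (mul_nonneg (hn _ _) (tB_nonneg h0 (by linarith) _ _))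
  have f := fano2 (d := bconv α d) (hV true 0) (hV true 1) (hV false 0) (hV false 1)
    (by simp [VV, tB]; linear_combination hq true + hq false)
    (by
      refine le_trans (le_of_eq ?_) (bconv_le h1 he)
      simp [VV, tB, bconv]
      linear_combination α * (hq true + hq false))
    (by unfold bconv; nlinarith)
  simp only [Fin.sum_univ_two]
  unfold KK at *
  have e1 : VV q (tB α) true 0 + VV q (tB α) false 0 = 1 / 2 := by
    simp [VV, tB]; linear_combination (1 - α) * hq true + α * hq false
  have e2 : VV q (tB α) true 1 + VV q (tB α) false 1 = 1 / 2 := by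
    simp [VV, tB]; linear_combination α * hq true + (1 - α) * hq false
  have e3 : ∀ y, VV q (tB α) y 0 + VV q (tB α) y 1 = q true y + q false y := by
    intro y; simp [VV, tB]; ring
  rw [e1, e2, eta_half]
  rw [e3, e3] at f
  linarith

/-- The mutual information `I(S;Y)` (nats) for a uniform `S`. -/
def IQ (q : Bool → Bool → ℝ) : ℝ :=
  Real.negMulLog (q true true + q false true) + Real.negMulLog (q true false + q false false)
    - (Real.negMulLog (q true true) + Real.negMulLog (q true false) +
        Real.negMulLog (q false true) + Real.negMulLog (q false false)) + Real.log 2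

lemma IQ_ge {d : ℝ} (q : Bool → Bool → ℝ) (hn : ∀ s y, 0 ≤ q s y)
    (hq : ∀ s, q s true + q s false = 1 / 2) (he : q true false + q false true ≤ d)
    (hd : d ≤ 1 / 2) : Real.log 2 - Real.binEntropy d ≤ IQ q := by
  have f := fano2 (d := d) (hn true true) (hn false true) (hn true false) (hn false false)
    (by linarith [hq true, hq false]) (by linarith) hd
  unfold IQ
  unfold KK at f
  linarith

lemma tE_KK (β : ℝ) (q : Bool → Bool → ℝ) (hq : ∀ s, q s true + q s false = 1 / 2) :
    ∑ u, KK (VV q (tE β) true u) (VV q (tE β) false u) =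
    β * ((Real.negMulLog (q true true) + Real.negMulLog (q true false) +
        Real.negMulLog (q false true) + Real.negMulLog (q false false)) - Real.log 2) +
    (1 - β) * (Real.negMulLog (q true true + q false true) +
      Real.negMulLog (q true false + q false false)) := by
  have e0 : ∀ y, VV q (tE β) y 0 = β * q true y := by intro y; simp [VV, tE]; ring
  have e1 : ∀ y, VV q (tE β) y 1 = β * q false y := by intro y; simp [VV, tE]; ring
  have e2 : ∀ y, VV q (tE β) y 2 = (1 - β) * (q true y + q false y) := by
    intro y; simp [VV, tE]; ring
  simp only [Fin.sum_univ_three, e0, e1, e2, KK_smul]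
  unfold KK
  have e3 : q true true + q false true + (q true false + q false false) = 1 := by
    linarith [hq true, hq false]
  rw [hq, hq, e3, eta_half, Real.negMulLog_one]
  ring

lemma MI_tE (β : ℝ) (q : Bool → Bool → ℝ) (hq : ∀ s, q s true + q s false = 1 / 2) :
    MI (fun a : Fin 3 × Bool => VV q (tE β) a.2 a.1) * Real.log 2 = β * IQ q := by
  rw [MI_eq_s10 q _ (tE_sum β), tE_KK β q hq]; unfold IQ; ring

lemma CMI_tE (β : ℝ) (q : Bool → Bool → ℝ) (hq : ∀ s, q s true + q s false = 1 / 2) :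
    CMI (fun a : Bool × Bool × Fin 3 => q a.1 a.2.1 * tE β a.1 a.2.2) * Real.log 2
      = (1 - β) * IQ q := by
  rw [CMI_eq_s10 q _ hq (tE_sum β), tE_KK β q hq]; unfold IQ; ring

/-- Bias of the source given the auxiliary. -/
def ZZ {k : ℕ} (t : Bool → Fin k → ℝ) (u : Fin k) : ℝ :=
  (t true u - t false u) / (t true u + t false u)

/-- Law of the auxiliary. -/
def PP {k : ℕ} (t : Bool → Fin k → ℝ) (u : Fin k) : ℝ := (t true u + t false u) / 2

lemma ZZ_abs {k : ℕ} (t : Bool → Fin k → ℝ) (hn : ∀ s u, 0 ≤ t s u) (u : Fin k) :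
    |ZZ t u| ≤ 1 := by
  unfold ZZ
  rw [abs_div]
  apply div_le_one_of_le₀ _ (abs_nonneg _)
  have h1 := hn true u
  have h2 := hn false u
  rw [abs_of_nonneg (add_nonneg h1 h2), abs_le]
  constructor <;> linarith

lemma PP_sum {k : ℕ} (t : Bool → Fin k → ℝ) (ht : ∀ s, ∑ u, t s u = 1) : ∑ u, PP t u = 1 := by
  unfold PP
  rw [← Finset.sum_div, Finset.sum_add_distrib, ht, ht]; norm_num

lemma KK_bsc {k : ℕ} (d : ℝ) (q : Bool → Bool → ℝ)
    (hq : ∀ s y, q s y = (1/2) * (if y = s then 1 - d else d))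
    (t : Bool → Fin k → ℝ) (hn : ∀ s u, 0 ≤ t s u) (u : Fin k) :
    KK (VV q t true u) (VV q t false u) = PP t u * GG ((1 - 2 * d) * ZZ t u) := by
  have h1 := hn true u
  have h2 := hn false u
  rcases (add_nonneg h1 h2).eq_or_lt with h | h
  · have h3 : t true u = 0 := by linarith
    have h4 : t false u = 0 := by linarith
    simp [VV, PP, h3, h4, KK]
  · unfold GG
    rw [← KK_scaled, KK_comm]
    congr 1
    · simp [VV, hq, PP, ZZ]; field_simp; ring
    · simp [VV, hq, PP, ZZ]; field_simp; ring

lemma CMI_bsc {k : ℕ} (d : ℝ) (q : Bool → Bool → ℝ)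
    (hq : ∀ s y, q s y = (1/2) * (if y = s then 1 - d else d))
    (t : Bool → Fin k → ℝ) (hn : ∀ s u, 0 ≤ t s u) (ht : ∀ s, ∑ u, t s u = 1) :
    CMI (fun a : Bool × Bool × Fin k => q a.1 a.2.1 * t a.1 a.2.2) * Real.log 2 =
      ∑ u, PP t u * GG ((1 - 2 * d) * ZZ t u) - Real.binEntropy d := by
  rw [CMI_eq_s10 q t (fun s => by cases s <;> simp [hq] <;> ring) ht]
  simp only [KK_bsc d q hq t hn]
  simp only [hq, Real.negMulLog_mul, eta_half,
    Real.binEntropy_eq_negMulLog_add_negMulLog_one_sub]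
  simp
  ring

lemma MI_bsc {k : ℕ} (d : ℝ) (q : Bool → Bool → ℝ)
    (hq : ∀ s y, q s y = (1/2) * (if y = s then 1 - d else d))
    (t : Bool → Fin k → ℝ) (hn : ∀ s u, 0 ≤ t s u) (ht : ∀ s, ∑ u, t s u = 1) :
    MI (fun a : Fin k × Bool => VV q t a.2 a.1) * Real.log 2 =
      Real.log 2 - ∑ u, PP t u * GG ((1 - 2 * d) * ZZ t u) := by
  rw [MI_eq_s10 q t ht]
  simp only [KK_bsc d q hq t hn]
  have e1 : q true true + q false true = 1 / 2 := by simp [hq]; ring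
  have e2 : q true false + q false false = 1 / 2 := by simp [hq]; ring
  rw [e1, e2, eta_half]
  ring

lemma GG_mul_abs {c : ℝ} (hc : 0 ≤ c) (z : ℝ) : GG (c * |z|) = GG (c * z) := by
  rw [← GG_abs (c * z), abs_mul, abs_of_nonneg hc]

lemma GG_mul_ge {c z : ℝ} (hc : 0 ≤ c) (hc1 : c ≤ 1) (hz : |z| ≤ 1) : GG c ≤ GG (c * z) := by
  rw [← GG_mul_abs hc]
  have := abs_nonneg z
  exact GG_anti ⟨by positivity, by nlinarith⟩ ⟨hc, hc1⟩ (by nlinarith)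

lemma avg_const {k : ℕ} (P : Fin k → ℝ) (h1 : ∑ u, P u = 1) (x : ℝ) : ∑ u, P u * x = x := by
  rw [← Finset.sum_mul, h1, one_mul]

lemma conv1 {k : ℕ} (P z : Fin k → ℝ) (hP : ∀ u, 0 ≤ P u) (h1 : ∑ u, P u = 1)
    (hz : ∀ u, |z u| ≤ 1) {c1 c2 : ℝ} (hc2 : 0 ≤ c2) (hc : c2 ≤ c1) (hc1 : c1 ≤ 1) :
    ∃ z0 ∈ Set.Icc (0:ℝ) 1, ∑ u, P u * GG (c1 * z u) = GG (c1 * z0) ∧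
      GG (c2 * z0) ≤ ∑ u, P u * GG (c2 * z u) := by
  have hc10 : 0 ≤ c1 := hc2.trans hc
  have hcont : ContinuousOn (fun x : ℝ => GG (c1 * x)) (Set.Icc 0 1) :=
    (GG_cont.comp (continuous_const.mul continuous_id)).continuousOn
  have hmem : ∑ u, P u * GG (c1 * z u) ∈ Set.Icc (GG (c1 * 1)) (GG (c1 * 0)) := by
    rw [mul_one, mul_zero, GG_zero]
    constructor
    · rw [← avg_const P h1 (GG c1)]
      exact Finset.sum_le_sum fun u _ =>
        mul_le_mul_of_nonneg_left (GG_mul_ge hc10 hc1 (hz u)) (hP u)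
    · rw [← avg_const P h1 (Real.log 2)]
      exact Finset.sum_le_sum fun u _ => mul_le_mul_of_nonneg_left (GG_le _) (hP u)
  obtain ⟨z0, hz0, he⟩ := intermediate_value_Icc' zero_le_one hcont hmem
  simp only at he
  refine ⟨z0, hz0, he.symm, ?_⟩
  obtain ⟨c, hcc0, hcc1, hcc⟩ : ∃ c : ℝ, 0 ≤ c ∧ c ≤ 1 ∧ c2 = c * c1 := by
    rcases hc10.eq_or_lt with h | h
    · exact ⟨0, le_refl _, zero_le_one, by linarith⟩
    · exact ⟨c2 / c1, by positivity, by rw [div_le_one h]; exact hc, by field_simp⟩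
  obtain ⟨l, hl⟩ := gerber hcc0 hcc1 (w0 := c1 * z0)
    ⟨mul_nonneg hc10 hz0.1, by nlinarith [hz0.1, hz0.2]⟩
  have hu : ∀ u, P u * (GG (c2 * z0)) + l * (P u * GG (c1 * z u) - P u * GG (c1 * z0)) ≤
      P u * GG (c2 * z u) := by
    intro u
    have h := hl (c1 * |z u|) ⟨by positivity, by nlinarith [hz u, abs_nonneg (z u)]⟩
    rw [← mul_assoc, ← mul_assoc, ← hcc, GG_mul_abs hc2, GG_mul_abs hc10] at h
    have := mul_le_mul_of_nonneg_left h (hP u)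
    linarith
  have hs := Finset.sum_le_sum fun u (_ : u ∈ Finset.univ) => hu u
  rw [Finset.sum_add_distrib, ← Finset.mul_sum, Finset.sum_sub_distrib, avg_const P h1,
    avg_const P h1, he] at hs
  linarith

lemma conv2 {k : ℕ} (P z : Fin k → ℝ) (hP : ∀ u, 0 ≤ P u) (h1 : ∑ u, P u = 1)
    (hz : ∀ u, |z u| ≤ 1) {c1 c2 : ℝ} (hc2 : 0 ≤ c2) (hc : c2 ≤ c1) (hc1 : c1 ≤ 1) :
    ∃ β ∈ Set.Icc (0:ℝ) 1, Real.log 2 - ∑ u, P u * GG (c1 * z u) ≤ β * (Real.log 2 - GG c1) ∧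
      ∑ u, P u * GG (c2 * z u) - GG c2 ≤ (1 - β) * (Real.log 2 - GG c2) := by
  have hc10 : 0 ≤ c1 := hc2.trans hc
  have hlo : GG c1 ≤ ∑ u, P u * GG (c1 * z u) := by
    rw [← avg_const P h1 (GG c1)]
    exact Finset.sum_le_sum fun u _ =>
        mul_le_mul_of_nonneg_left (GG_mul_ge hc10 hc1 (hz u)) (hP u)
  have hup : ∀ c : ℝ, ∑ u, P u * GG (c * z u) ≤ Real.log 2 := fun c => by
    rw [← avg_const P h1 (Real.log 2)]
    exact Finset.sum_le_sum fun u _ => mul_le_mul_of_nonneg_left (GG_le _) (hP u)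
  have h12 : GG c1 ≤ GG c2 := GG_anti ⟨hc2, hc.trans hc1⟩ ⟨hc10, hc1⟩ hc
  rcases (GG_le c1).eq_or_lt with h | h
  · refine ⟨0, ⟨le_refl _, zero_le_one⟩, by linarith, by linarith [hup c2]⟩
  obtain ⟨c, hcc0, hcc1, hcc⟩ : ∃ c : ℝ, 0 ≤ c ∧ c ≤ 1 ∧ c2 = c * c1 := by
    rcases hc10.eq_or_lt with h | h
    · exact ⟨0, le_refl _, zero_le_one, by linarith⟩
    · exact ⟨c2 / c1, by positivity, by rw [div_le_one h]; exact hc, by field_simp⟩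
  have hpos : 0 < Real.log 2 - GG c1 := by linarith
  refine ⟨(Real.log 2 - ∑ u, P u * GG (c1 * z u)) / (Real.log 2 - GG c1),
    ⟨div_nonneg (by linarith [hup c1]) hpos.le, by rw [div_le_one hpos]; linarith⟩, ?_, ?_⟩
  · rw [div_mul_cancel₀ _ hpos.ne']
  have hu : ∀ u, (P u * Real.log 2 - P u * GG (c1 * z u)) * (Real.log 2 - GG c2) ≤
      (P u * Real.log 2 - P u * GG (c2 * z u)) * (Real.log 2 - GG c1) := by
    intro u
    have h := gerber_ratio hcc0 hcc1 (w := c1) (v := c1 * |z u|) ⟨hc10, hc1⟩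
      ⟨by positivity, by nlinarith [hz u, abs_nonneg (z u)]⟩ (by nlinarith [hz u])
    rw [← mul_assoc, ← hcc, GG_mul_abs hc2, GG_mul_abs hc10] at h
    have := mul_le_mul_of_nonneg_left h (hP u)
    linarith
  have hs := Finset.sum_le_sum fun u (_ : u ∈ Finset.univ) => hu u
  rw [← Finset.sum_mul, ← Finset.sum_mul, Finset.sum_sub_distrib, Finset.sum_sub_distrib,
    avg_const P h1] at hs
  have h3 : (Real.log 2 - ∑ u, P u * GG (c1 * z u)) / (Real.log 2 - GG c1) *
      (Real.log 2 - GG c2) ≤ Real.log 2 - ∑ u, P u * GG (c2 * z u) := by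
    rw [div_mul_eq_mul_div, div_le_iff₀ hpos]; exact hs
  linarith

lemma Hb_GG (α d : ℝ) : Real.binEntropy (bconv α d) = GG ((1 - 2 * d) * (1 - 2 * α)) := by
  unfold GG bconv; congr 1; ring

lemma inner_bound (d1 d2 : ℝ) (h0 : 0 ≤ d1) (h12 : d1 ≤ d2) (h2 : d2 ≤ 1/2)
    (q1 q2 : Bool → Bool → ℝ) (hn1 : ∀ s y, 0 ≤ q1 s y) (hn2 : ∀ s y, 0 ≤ q2 s y)
    (hq1 : ∀ s, q1 s true + q1 s false = 1 / 2) (hq2 : ∀ s, q2 s true + q2 s false = 1 / 2)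
    (p : Bool × Bool × Bool → ℝ)
    (e1 : ∀ s y, ∑ u2, p (s, y, u2) = q1 s y) (e2 : ∀ s y, ∑ u1, p (s, u1, y) = q2 s y)
    (he1 : q1 true false + q1 false true ≤ d1) (he2 : q2 true false + q2 false true ≤ d2) :
    CBSBC d1 d2 ⊆ Rreg1 p ∧ CtBSBC d1 d2 ⊆ Rreg2 p := by
  have hl := log2_pos
  constructor
  · rintro ⟨R1, R2⟩ ⟨hR1, hR2, α, hα, g1, g2⟩
    refine ⟨hR1, hR2, 2, tB α, fun s => ⟨tB_nonneg hα.1 (by linarith [hα.2]) s, tB_sum α s⟩, ?_, ?_⟩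
    · simp only [e1]
      have := CMI_tB hα.1 (by linarith [hα.2]) q1 hn1 hq1 he1 (by linarith)
      rw [← Hb_eq, ← Hb_eq, ← sub_mul] at this
      exact g1.trans (le_of_mul_le_mul_right this hl)
    · simp only [← Finset.sum_mul, e2, Fintype.sum_bool]
      have := MI_tB hα.1 hα.2 q2 hn2 hq2 he2 h2
      rw [← Hb_eq] at this
      refine g2.trans (le_of_mul_le_mul_right (le_trans (le_of_eq ?_) this) hl)
      ring
  · rintro ⟨R1, R2⟩ ⟨hR1, hR2, β, hβ, g1, g2⟩
    refine ⟨hR1, hR2, 3, tE β, fun s => ⟨tE_nonneg hβ.1 hβ.2 s, tE_sum β s⟩, ?_, ?_⟩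
    · simp only [← Finset.sum_mul, e1, Fintype.sum_bool]
      have := MI_tE β q1 hq1
      have h3 := mul_le_mul_of_nonneg_left (IQ_ge q1 hn1 hq1 he1 (by linarith)) hβ.1
      rw [← Hb_eq] at h3
      refine g1.trans (le_of_mul_le_mul_right (le_trans (le_of_eq ?_) (h3.trans this.ge)) hl)
      ring
    · simp only [e2]
      have := CMI_tE β q2 hq2
      have h3 := mul_le_mul_of_nonneg_left (IQ_ge q2 hn2 hq2 he2 h2) (sub_nonneg.2 hβ.2)
      rw [← Hb_eq] at h3
      refine g2.trans (le_of_mul_le_mul_right (le_trans (le_of_eq ?_) (h3.trans this.ge)) hl)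
      ring

lemma outer_bound (d1 d2 : ℝ) (h0 : 0 ≤ d1) (h12 : d1 ≤ d2) (h2 : d2 ≤ 1/2)
    (p : Bool × Bool × Bool → ℝ)
    (e1 : ∀ s u1, ∑ u2, p (s, u1, u2) = (1/2) * (if u1 = s then 1 - d1 else d1))
    (e2 : ∀ s u2, ∑ u1, p (s, u1, u2) = (1/2) * (if u2 = s then 1 - d2 else d2)) :
    Rreg1 p ⊆ CBSBC d1 d2 ∧ Rreg2 p ⊆ CtBSBC d1 d2 := by
  have hl := log2_pos
  obtain ⟨q1, hq1⟩ : ∃ q : Bool → Bool → ℝ,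
    ∀ s y, q s y = (1/2) * (if y = s then 1 - d1 else d1) := ⟨_, fun _ _ => rfl⟩
  obtain ⟨q2, hq2⟩ : ∃ q : Bool → Bool → ℝ,
    ∀ s y, q s y = (1/2) * (if y = s then 1 - d2 else d2) := ⟨_, fun _ _ => rfl⟩
  have e1' : ∀ s y, ∑ u2, p (s, y, u2) = q1 s y := fun s y => by rw [e1, hq1]
  have e2' : ∀ s y, ∑ u1, p (s, u1, y) = q2 s y := fun s y => by rw [e2, hq2]
  have hgd : ∀ d : ℝ, Real.binEntropy d = GG (1 - 2 * d) := fun d => by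
    unfold GG; congr 1; ring
  have hPn : ∀ {k : ℕ} (t : Bool → Fin k → ℝ), (∀ s u, 0 ≤ t s u) → ∀ u, 0 ≤ PP t u :=
    fun t ht u => div_nonneg (add_nonneg (ht _ _) (ht _ _)) (by norm_num)
  constructor
  · rintro ⟨R1, R2⟩ ⟨hR1, hR2, k, t, ht, g1, g2⟩
    simp only [e1'] at g1
    simp only [← Finset.sum_mul, e2', Fintype.sum_bool] at g2
    have hn : ∀ s u, 0 ≤ t s u := fun s => (ht s).1
    have hs : ∀ s, ∑ u, t s u = 1 := fun s => (ht s).2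
    have a := CMI_bsc d1 q1 hq1 t hn hs
    have b := MI_bsc d2 q2 hq2 t hn hs
    obtain ⟨z0, hz0, f1, f2⟩ := conv1 (PP t) (ZZ t) (hPn t hn) (PP_sum t hs) (ZZ_abs t hn)
      (c1 := 1 - 2 * d1) (c2 := 1 - 2 * d2) (by linarith) (by linarith) (by linarith)
    have ez : 1 - 2 * ((1 - z0) / 2) = z0 := by ring
    refine ⟨hR1, hR2, (1 - z0) / 2, ⟨by linarith [hz0.2], by linarith [hz0.1]⟩, ?_, ?_⟩
    · refine g1.trans (le_of_mul_le_mul_right (le_of_eq ?_) hl)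
      rw [sub_mul, Hb_eq, Hb_eq, Hb_GG, ez, ← f1]
      exact a
    · refine g2.trans (le_of_mul_le_mul_right (b.le.trans ?_) hl)
      rw [sub_mul, Hb_eq, Hb_GG, ez]
      linarith
  · rintro ⟨R1, R2⟩ ⟨hR1, hR2, k, t, ht, g1, g2⟩
    simp only [e2'] at g2
    simp only [← Finset.sum_mul, e1', Fintype.sum_bool] at g1
    have hn : ∀ s u, 0 ≤ t s u := fun s => (ht s).1
    have hs : ∀ s, ∑ u, t s u = 1 := fun s => (ht s).2
    have a := CMI_bsc d2 q2 hq2 t hn hs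
    have b := MI_bsc d1 q1 hq1 t hn hs
    obtain ⟨β, hβ, f1, f2⟩ := conv2 (PP t) (ZZ t) (hPn t hn) (PP_sum t hs) (ZZ_abs t hn)
      (c1 := 1 - 2 * d1) (c2 := 1 - 2 * d2) (by linarith) (by linarith) (by linarith)
    refine ⟨hR1, hR2, β, hβ, ?_, ?_⟩
    · refine g1.trans (le_of_mul_le_mul_right (b.le.trans (f1.trans (le_of_eq ?_))) hl)
      rw [← hgd, ← Hb_eq]; ring
    · rw [hgd] at a
      refine g2.trans (le_of_mul_le_mul_right (a.le.trans (f2.trans (le_of_eq ?_))) hl)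
      rw [← hgd, ← Hb_eq]; ring

/-- **Proposition 9.** For the uniform binary source:
(i) if `Pr{S ≠ Ŝᵢ} ≤ dᵢ` with `d₁ ≤ d₂ ≤ 1/2`, then
`ℛ₁ ⊇ 𝒞(BS-BC(d₁,d₂))` and `ℛ₂ ⊇ 𝒞̃(BS-BC(d₁,d₂))`;
(ii) if moreover `p_{Ŝᵢ|S}` is a `BSC(dᵢ)`, then equalities hold. -/
theorem binary_Rregions
    (d1 d2 : ℝ) (h0 : 0 ≤ d1) (h12 : d1 ≤ d2) (h2 : d2 ≤ 1/2)
    (p : Bool × Bool × Bool → ℝ) (hp : IsPMF p)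
    (hunif : ∀ s, ∑ u1, ∑ u2, p (s, u1, u2) = 1/2) :
    ((∑ a : Bool × Bool × Bool, p a * (if a.1 = a.2.1 then 0 else 1)) ≤ d1 →
     (∑ a : Bool × Bool × Bool, p a * (if a.1 = a.2.2 then 0 else 1)) ≤ d2 →
      CBSBC d1 d2 ⊆ Rreg1 p ∧ CtBSBC d1 d2 ⊆ Rreg2 p) ∧
    ((∀ s u1, ∑ u2, p (s, u1, u2) = (1/2) * (if u1 = s then 1 - d1 else d1)) →
     (∀ s u2, ∑ u1, p (s, u1, u2) = (1/2) * (if u2 = s then 1 - d2 else d2)) →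
      Rreg1 p = CBSBC d1 d2 ∧ Rreg2 p = CtBSBC d1 d2) := by
  have part1 : (∑ a : Bool × Bool × Bool, p a * (if a.1 = a.2.1 then 0 else 1)) ≤ d1 →
     (∑ a : Bool × Bool × Bool, p a * (if a.1 = a.2.2 then 0 else 1)) ≤ d2 →
      CBSBC d1 d2 ⊆ Rreg1 p ∧ CtBSBC d1 d2 ⊆ Rreg2 p := by
    intro c1 c2
    simp [Fintype.sum_prod_type] at c1 c2
    have ht := hunif true
    have hf := hunif false
    simp only [Fintype.sum_bool] at ht hf
    refine inner_bound d1 d2 h0 h12 h2 (fun s y => ∑ u2, p (s, y, u2))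
      (fun s y => ∑ u1, p (s, u1, y)) (fun s y => Finset.sum_nonneg fun _ _ => hp.1 _)
      (fun s y => Finset.sum_nonneg fun _ _ => hp.1 _) ?_ ?_ p (fun _ _ => rfl) (fun _ _ => rfl)
      ?_ ?_
    · intro s; cases s <;> simp only [Fintype.sum_bool] <;> linarith
    · intro s; cases s <;> simp only [Fintype.sum_bool] <;> linarith
    · simp only [Fintype.sum_bool]; linarith
    · simp only [Fintype.sum_bool]; linarith
  refine ⟨part1, fun e1 e2 => ?_⟩
  have hin := part1 (by
      have a := e1 true false
      have b := e1 false true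
      simp [Fintype.sum_prod_type] at a b ⊢
      linarith) (by
      have a := e2 true false
      have b := e2 false true
      simp [Fintype.sum_prod_type] at a b ⊢
      linarith)
  have hout := outer_bound d1 d2 h0 h12 h2 p e1 e2
  exact ⟨hout.1.antisymm hin.1, hout.2.antisymm hin.2⟩

end
end
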